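/- For every integer n ≥ 2, every integer k ≥ 2 and every exponent 1 < p ≤ 2 there exist ε₀ > 0 and R₀ > 0, depending only on n, k, p, with the following property: let 0 < T ≤ ∞ and let u₁, u₂ : ℝⁿ × [0,T) → ℝ^k be continuous maps into the unit sphere S^{k−1} (|u_i| ≡ 1) which are smooth on ℝⁿ × (0,T) and solve the harmonic map heat flow ∂_t u_i = Δu_i + |∇u_i|² u_i there, which satisfy ∫₀^T ∫_{ℝⁿ} (|∇u_i|² + |∂_t u_i|²) < ∞, which have the same initial value u₁(·,0) = u₂(·,0), and which satisfy the parabolic Morrey smallness condition ‖∇u_i‖_{M^{p,p}_{R₀}} + ‖∂_t u_i‖_{M^{p,2p}_{R₀}} ≤ ε₀ for i = 1,2. Then u₁ ≡ u₂ on ℝⁿ × [0,T). -/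

import Mathlib

open MeasureTheory Metric Set Filter Real

noncomputable section

abbrev Sp (n : ℕ) := EuclideanSpace ℝ (Fin n)

/-- The `α`-th spatial coordinate direction in spacetime `ℝⁿ × ℝ`. -/
def sdir (n : ℕ) (α : Fin n) : Sp n × ℝ := (EuclideanSpace.single α 1, 0)

/-- The time direction in spacetime `ℝⁿ × ℝ`. -/
def tdir (n : ℕ) : Sp n × ℝ := (0, 1)

/-- Directional derivative of the `i`-th component of `u` in direction `v`. -/
def pd {n k : ℕ} (u : Sp n × ℝ → Fin k → ℝ) (i : Fin k) (v : Sp n × ℝ) (z : Sp n × ℝ) : ℝ :=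
  fderiv ℝ (fun w => u w i) z v

/-- Squared spatial gradient `|∇u|²`. -/
def gradSq {n k : ℕ} (u : Sp n × ℝ → Fin k → ℝ) (z : Sp n × ℝ) : ℝ :=
  ∑ α : Fin n, ∑ i : Fin k, (pd u i (sdir n α) z) ^ 2

/-- Squared time derivative `|∂ₜu|²`. -/
def dtSq {n k : ℕ} (u : Sp n × ℝ → Fin k → ℝ) (z : Sp n × ℝ) : ℝ :=
  ∑ i : Fin k, (pd u i (tdir n) z) ^ 2

/-- Spatial Laplacian `Δuⁱ`. -/
def lap {n k : ℕ} (u : Sp n × ℝ → Fin k → ℝ) (i : Fin k) (z : Sp n × ℝ) : ℝ :=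
  ∑ α : Fin n, fderiv ℝ (pd u i (sdir n α)) z (sdir n α)

/-- `u` takes values in the unit sphere `S^{k-1}` on `D`. -/
def SphereValued {n k : ℕ} (u : Sp n × ℝ → Fin k → ℝ) (D : Set (Sp n × ℝ)) : Prop :=
  ∀ z ∈ D, ∑ i : Fin k, (u z i) ^ 2 = 1

/-- `u` solves the harmonic map heat flow `∂ₜu = Δu + |∇u|² u` into the sphere on `D`. -/
def HeatFlow {n k : ℕ} (u : Sp n × ℝ → Fin k → ℝ) (D : Set (Sp n × ℝ)) : Prop :=
  ∀ z ∈ D, ∀ i : Fin k, pd u i (tdir n) z = lap u i z + gradSq u z * u z i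

/-- Parabolic cylinder `P_r(z₀) = closedBall(x₀,r) × (t₀ - r², t₀]`. -/
def pcyl {n : ℕ} (z₀ : Sp n × ℝ) (r : ℝ) : Set (Sp n × ℝ) :=
  closedBall z₀.1 r ×ˢ Ioc (z₀.2 - r ^ 2) z₀.2

/-- The restricted parabolic Morrey smallness condition
`‖∇u‖_{M^{p,p}_{R₀}} + ‖∂ₜu‖_{M^{p,2p}_{R₀}} ≤ ε` on the strip `ℝⁿ × (0,T)`. -/
def MorreySmall {n k : ℕ} (u : Sp n × ℝ → Fin k → ℝ) (T : EReal) (p R₀ ε : ℝ) : Prop :=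
  ∃ A B : ℝ, A + B ≤ ε ∧
    (∀ (x : Sp n) (t r : ℝ), 0 < t → (t : EReal) < T → 0 < r → r < min R₀ (Real.sqrt t) →
      (r ^ (p - n - 2) * ∫ w in pcyl (x, t) r, (gradSq u w) ^ (p / 2)) ^ (1 / p) ≤ A) ∧
    (∀ (x : Sp n) (t r : ℝ), 0 < t → (t : EReal) < T → 0 < r → r < min R₀ (Real.sqrt t) →
      (r ^ (2 * p - n - 2) * ∫ w in pcyl (x, t) r, (dtSq u w) ^ (p / 2)) ^ (1 / p) ≤ B)

/-- Directional derivative of a scalar function. -/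
def dirDeriv {E : Type*} [NormedAddCommGroup E] [NormedSpace ℝ E] (v : E) (f : E → ℝ) (z : E) : ℝ :=
  fderiv ℝ f z v

/-- Smoothness of a scalar function on a set. -/
abbrev SmoothOn {E : Type*} [NormedAddCommGroup E] [NormedSpace ℝ E] (f : E → ℝ) (U : Set E) : Prop :=
  ContDiffOn ℝ (⊤ : ℕ∞) f U

section DirDeriv

variable {E : Type*} [NormedAddCommGroup E] [NormedSpace ℝ E] {U : Set E} {f g : E → ℝ} {z : E}

lemma SmoothOn.differentiableAt (hU : IsOpen U) (hf : SmoothOn f U) (hz : z ∈ U) :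
    DifferentiableAt ℝ f z :=
  (hf.contDiffAt (hU.mem_nhds hz)).differentiableAt (by simp)

lemma SmoothOn.dirDeriv (hU : IsOpen U) (hf : SmoothOn f U) (v : E) :
    SmoothOn (dirDeriv v f) U := by
  have h : ContDiffOn ℝ (⊤ : ℕ∞) (fderiv ℝ f) U := hf.fderiv_of_isOpen hU (by simp)
  exact h.clm_apply contDiffOn_const

lemma dirDeriv_congr (hU : IsOpen U) (hz : z ∈ U) (h : ∀ y ∈ U, f y = g y) (v : E) :
    dirDeriv v f z = dirDeriv v g z := by
  have : f =ᶠ[nhds z] g := Filter.eventuallyEq_of_mem (hU.mem_nhds hz) h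
  simp only [dirDeriv, this.fderiv_eq]

lemma dirDeriv_add (hf : DifferentiableAt ℝ f z) (hg : DifferentiableAt ℝ g z) (v : E) :
    dirDeriv v (fun y => f y + g y) z = dirDeriv v f z + dirDeriv v g z := by
  simp [dirDeriv, fderiv_fun_add hf hg]

lemma dirDeriv_sub (hf : DifferentiableAt ℝ f z) (hg : DifferentiableAt ℝ g z) (v : E) :
    dirDeriv v (fun y => f y - g y) z = dirDeriv v f z - dirDeriv v g z := by
  simp [dirDeriv, fderiv_fun_sub hf hg]

lemma dirDeriv_mul (hf : DifferentiableAt ℝ f z) (hg : DifferentiableAt ℝ g z) (v : E) :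
    dirDeriv v (fun y => f y * g y) z = f z * dirDeriv v g z + g z * dirDeriv v f z := by
  simp [dirDeriv, fderiv_fun_mul hf hg]

lemma dirDeriv_sum {ι : Type*} (s : Finset ι) {f : ι → E → ℝ}
    (hf : ∀ i ∈ s, DifferentiableAt ℝ (f i) z) (v : E) :
    dirDeriv v (fun y => ∑ i ∈ s, f i y) z = ∑ i ∈ s, dirDeriv v (f i) z := by
  simp [dirDeriv, fderiv_fun_sum hf]

lemma dirDeriv_sq (hf : DifferentiableAt ℝ f z) (v : E) :
    dirDeriv v (fun y => f y ^ 2) z = 2 * f z * dirDeriv v f z := by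
  simp only [pow_two]
  rw [dirDeriv_mul hf hf]
  ring

lemma dirDeriv_const (c : ℝ) (v : E) : dirDeriv v (fun _ : E => c) z = 0 := by
  simp [dirDeriv]

lemma dirDeriv_comm (hU : IsOpen U) (hf : SmoothOn f U) (hz : z ∈ U) (v w : E) :
    dirDeriv v (dirDeriv w f) z = dirDeriv w (dirDeriv v f) z := by
  have hd : DifferentiableAt ℝ (fderiv ℝ f) z := by
    have h : ContDiffOn ℝ (⊤ : ℕ∞) (fderiv ℝ f) U := hf.fderiv_of_isOpen hU (by simp)
    exact (h.contDiffAt (hU.mem_nhds hz)).differentiableAt (by simp)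
  have key : ∀ v w : E, dirDeriv v (dirDeriv w f) z = fderiv ℝ (fderiv ℝ f) z v w := by
    intro v w
    have : fderiv ℝ (fun y => fderiv ℝ f y w) z = _ :=
      fderiv_clm_apply hd (differentiableAt_const w)
    change fderiv ℝ (fun y => fderiv ℝ f y w) z v = _
    rw [this]
    simp
  rw [key, key]
  refine ((hf.contDiffAt (hU.mem_nhds hz)).isSymmSndFDerivAt ?_) v w
  simp [minSmoothness_of_isRCLikeNormedField]
  exact WithTop.coe_le_coe.2 le_top

end DirDeriv

section HeatOperator

variable {n : ℕ} {U : Set (Sp n × ℝ)} {f g : Sp n × ℝ → ℝ} {z : Sp n × ℝ}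

/-- The spatial Laplacian of a scalar function on spacetime. -/
def spaceLap {n : ℕ} (f : Sp n × ℝ → ℝ) (z : Sp n × ℝ) : ℝ :=
  ∑ α : Fin n, dirDeriv (sdir n α) (dirDeriv (sdir n α) f) z

/-- The heat operator `∂ₜ - Δ`. -/
def heatOp {n : ℕ} (f : Sp n × ℝ → ℝ) (z : Sp n × ℝ) : ℝ :=
  dirDeriv (tdir n) f z - spaceLap f z

lemma SmoothOn.spaceLap (hU : IsOpen U) (hf : SmoothOn f U) : SmoothOn (spaceLap f) U :=
  ContDiffOn.sum fun α _ => (hf.dirDeriv hU (sdir n α)).dirDeriv hU (sdir n α)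

lemma dirDeriv_heatOp (hU : IsOpen U) (hf : SmoothOn f U) (hz : z ∈ U) (v : Sp n × ℝ) :
    dirDeriv v (heatOp f) z = heatOp (dirDeriv v f) z := by
  have h1 : dirDeriv v (heatOp f) z
      = dirDeriv v (dirDeriv (tdir n) f) z - dirDeriv v (spaceLap f) z :=
    dirDeriv_sub ((hf.dirDeriv hU _).differentiableAt hU hz)
      ((hf.spaceLap hU).differentiableAt hU hz) v
  have h2 : dirDeriv v (spaceLap f) z
      = ∑ α : Fin n, dirDeriv v (dirDeriv (sdir n α) (dirDeriv (sdir n α) f)) z :=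
    dirDeriv_sum _ (fun α _ => ((hf.dirDeriv hU _).dirDeriv hU _).differentiableAt hU hz) v
  rw [h1, h2, heatOp, spaceLap, dirDeriv_comm hU hf hz]
  congr 1
  refine Finset.sum_congr rfl fun α _ => ?_
  rw [dirDeriv_comm hU (hf.dirDeriv hU _) hz]
  exact dirDeriv_congr hU hz (fun y hy => dirDeriv_comm hU hf hy v (sdir n α)) _

lemma heatOp_sub (hU : IsOpen U) (hf : SmoothOn f U) (hg : SmoothOn g U) (hz : z ∈ U) :
    heatOp (fun y => f y - g y) z = heatOp f z - heatOp g z := by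
  simp only [heatOp, spaceLap]
  rw [dirDeriv_sub (hf.differentiableAt hU hz) (hg.differentiableAt hU hz)]
  have : ∀ α : Fin n, dirDeriv (sdir n α) (dirDeriv (sdir n α) fun y => f y - g y) z
      = dirDeriv (sdir n α) (dirDeriv (sdir n α) f) z
        - dirDeriv (sdir n α) (dirDeriv (sdir n α) g) z := by
    intro α
    rw [← dirDeriv_sub ((hf.dirDeriv hU _).differentiableAt hU hz)
      ((hg.dirDeriv hU _).differentiableAt hU hz)]
    exact dirDeriv_congr hU hz (fun y hy =>
      dirDeriv_sub (hf.differentiableAt hU hy) (hg.differentiableAt hU hy) _) _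
  simp only [this, Finset.sum_sub_distrib]
  ring

lemma heatOp_sum {ι : Type*} (s : Finset ι) {f : ι → Sp n × ℝ → ℝ} (hU : IsOpen U)
    (hf : ∀ i, SmoothOn (f i) U) (hz : z ∈ U) :
    heatOp (fun y => ∑ i ∈ s, f i y) z = ∑ i ∈ s, heatOp (f i) z := by
  simp only [heatOp, spaceLap]
  rw [dirDeriv_sum s (fun i _ => (hf i).differentiableAt hU hz), Finset.sum_sub_distrib,
    Finset.sum_comm]
  congr 1
  refine Finset.sum_congr rfl fun α _ => ?_
  rw [← dirDeriv_sum s (fun i _ => ((hf i).dirDeriv hU _).differentiableAt hU hz)]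
  exact dirDeriv_congr hU hz (fun y hy =>
    dirDeriv_sum s (fun i _ => (hf i).differentiableAt hU hy) _) _

lemma spaceLap_mul (hU : IsOpen U) (hf : SmoothOn f U) (hg : SmoothOn g U) (hz : z ∈ U) :
    spaceLap (fun y => f y * g y) z = f z * spaceLap g z + g z * spaceLap f z
      + 2 * ∑ α : Fin n, dirDeriv (sdir n α) f z * dirDeriv (sdir n α) g z := by
  simp only [spaceLap, Finset.mul_sum, ← Finset.sum_add_distrib]
  refine Finset.sum_congr rfl fun α _ => ?_
  have hf' := hf.dirDeriv hU (sdir n α)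
  have hg' := hg.dirDeriv hU (sdir n α)
  rw [dirDeriv_congr hU hz (fun y hy =>
      dirDeriv_mul (hf.differentiableAt hU hy) (hg.differentiableAt hU hy) (sdir n α)),
    dirDeriv_add (SmoothOn.differentiableAt hU (hf.mul hg') hz)
      (SmoothOn.differentiableAt hU (hg.mul hf') hz),
    dirDeriv_mul (hf.differentiableAt hU hz) (hg'.differentiableAt hU hz),
    dirDeriv_mul (hg.differentiableAt hU hz) (hf'.differentiableAt hU hz)]
  ring

lemma heatOp_sq_le (hU : IsOpen U) (hf : SmoothOn f U) (hz : z ∈ U) :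
    heatOp (fun y => f y ^ 2) z ≤ 2 * f z * heatOp f z := by
  have h := spaceLap_mul hU hf hf hz
  simp only [← pow_two] at h
  rw [heatOp, heatOp, h, dirDeriv_sq (hf.differentiableAt hU hz)]
  have : 0 ≤ ∑ α : Fin n, dirDeriv (sdir n α) f z ^ 2 :=
    Finset.sum_nonneg fun α _ => sq_nonneg _
  nlinarith

lemma heatOp_sum_sq_le {ι : Type*} (s : Finset ι) {f : ι → Sp n × ℝ → ℝ} (hU : IsOpen U)
    (hf : ∀ i, SmoothOn (f i) U) (hz : z ∈ U) :
    heatOp (fun y => ∑ i ∈ s, f i y ^ 2) z ≤ ∑ i ∈ s, 2 * f i z * heatOp (f i) z := by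
  rw [heatOp_sum s (f := fun i y => f i y ^ 2) hU (fun i => (hf i).pow 2) hz]
  exact Finset.sum_le_sum fun i _ => heatOp_sq_le hU (hf i) hz

end HeatOperator

section SphereFlow

variable {n k : ℕ} {U : Set (Sp n × ℝ)} {u u₁ u₂ : Sp n × ℝ → Fin k → ℝ} {z : Sp n × ℝ}

lemma smoothOn_component (hu : ContDiffOn ℝ (⊤ : ℕ∞) u U) (i : Fin k) :
    SmoothOn (fun y => u y i) U :=
  (contDiffOn_pi.1 hu) i

lemma gradSq_eq_sum_sq (u : Sp n × ℝ → Fin k → ℝ) : gradSq u = fun z =>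
    ∑ j : Fin n × Fin k, (dirDeriv (sdir n j.1) (fun y => u y j.2) z) ^ 2 := by
  funext z
  rw [Fintype.sum_prod_type]
  rfl

lemma gradSq_nonneg (u : Sp n × ℝ → Fin k → ℝ) (z : Sp n × ℝ) : 0 ≤ gradSq u z :=
  Finset.sum_nonneg fun _ _ => Finset.sum_nonneg fun _ _ => sq_nonneg _

lemma dtSq_nonneg (u : Sp n × ℝ → Fin k → ℝ) (z : Sp n × ℝ) : 0 ≤ dtSq u z :=
  Finset.sum_nonneg fun _ _ => sq_nonneg _

lemma smoothOn_gradSq (hU : IsOpen U) (hu : ContDiffOn ℝ (⊤ : ℕ∞) u U) : SmoothOn (gradSq u) U :=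
  ContDiffOn.sum fun α _ => ContDiffOn.sum fun i _ =>
    ((smoothOn_component hu i).dirDeriv hU (sdir n α)).pow 2

lemma smoothOn_dtSq (hU : IsOpen U) (hu : ContDiffOn ℝ (⊤ : ℕ∞) u U) : SmoothOn (dtSq u) U :=
  ContDiffOn.sum fun i _ => ((smoothOn_component hu i).dirDeriv hU (tdir n)).pow 2

lemma HeatFlow.heatOp_eq (h : HeatFlow u U) (hz : z ∈ U) (i : Fin k) :
    heatOp (fun y => u y i) z = gradSq u z * u z i := by
  have : dirDeriv (tdir n) (fun y => u y i) z
      = spaceLap (fun y => u y i) z + gradSq u z * u z i := h z hz i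
  rw [heatOp, this]
  ring

/-- Bochner inequality for the energy density of the heat flow into the sphere. -/
lemma HeatFlow.heatOp_gradSq_le (hU : IsOpen U) (hu : ContDiffOn ℝ (⊤ : ℕ∞) u U)
    (h : HeatFlow u U) (hs : SphereValued u U) (hz : z ∈ U) :
    heatOp (gradSq u) z ≤ 2 * gradSq u z ^ 2 := by
  have hc := fun i => smoothOn_component hu i
  have he := smoothOn_gradSq hU hu
  have h1 := heatOp_sum_sq_le Finset.univ
    (f := fun (j : Fin n × Fin k) => dirDeriv (sdir n j.1) (fun y => u y j.2)) hU
    (fun j => (hc j.2).dirDeriv hU _) hz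
  rw [← gradSq_eq_sum_sq] at h1
  refine h1.trans ?_
  rw [Fintype.sum_prod_type]
  have h2 : ∀ (α : Fin n) (i : Fin k), heatOp (dirDeriv (sdir n α) (fun y => u y i)) z
      = gradSq u z * dirDeriv (sdir n α) (fun y => u y i) z
        + u z i * dirDeriv (sdir n α) (gradSq u) z := by
    intro α i
    rw [← dirDeriv_heatOp hU (hc i) hz, dirDeriv_congr hU hz (fun y hy => h.heatOp_eq hy i),
      dirDeriv_mul (he.differentiableAt hU hz) ((hc i).differentiableAt hU hz)]
  have h3 : ∀ α : Fin n, ∑ i : Fin k, 2 * u z i * dirDeriv (sdir n α) (fun y => u y i) z = 0 := by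
    intro α
    have h4 : dirDeriv (sdir n α) (fun y => ∑ i : Fin k, u y i ^ 2) z = 0 := by
      rw [dirDeriv_congr hU hz hs, dirDeriv_const]
    rw [dirDeriv_sum Finset.univ (fun i _ =>
      SmoothOn.differentiableAt hU ((hc i).pow 2) hz)] at h4
    rw [← h4]
    exact Finset.sum_congr rfl fun i _ => (dirDeriv_sq ((hc i).differentiableAt hU hz) _).symm
  have h5 : ∀ α : Fin n, ∑ i : Fin k, 2 * dirDeriv (sdir n α) (fun y => u y i) z
      * heatOp (dirDeriv (sdir n α) (fun y => u y i)) z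
      = 2 * gradSq u z * ∑ i : Fin k, dirDeriv (sdir n α) (fun y => u y i) z ^ 2 := by
    intro α
    have : ∀ i : Fin k, 2 * dirDeriv (sdir n α) (fun y => u y i) z
      * heatOp (dirDeriv (sdir n α) (fun y => u y i)) z
      = 2 * gradSq u z * dirDeriv (sdir n α) (fun y => u y i) z ^ 2
        + dirDeriv (sdir n α) (gradSq u) z
          * (2 * u z i * dirDeriv (sdir n α) (fun y => u y i) z) := by
      intro i
      rw [h2]
      ring
    simp only [this, Finset.sum_add_distrib, ← Finset.mul_sum, h3]
    ring
  simp only [h5, ← Finset.mul_sum]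
  have h6 : ∑ α : Fin n, ∑ i : Fin k, dirDeriv (sdir n α) (fun y => u y i) z ^ 2 = gradSq u z := rfl
  rw [h6]
  apply le_of_eq
  ring

/-- The squared distance of two flows into the sphere is a subsolution. -/
lemma HeatFlow.heatOp_dist_sq_le (hU : IsOpen U) (hu₁ : ContDiffOn ℝ (⊤ : ℕ∞) u₁ U)
    (hu₂ : ContDiffOn ℝ (⊤ : ℕ∞) u₂ U) (h₁ : HeatFlow u₁ U) (h₂ : HeatFlow u₂ U)
    (hs₁ : SphereValued u₁ U) (hs₂ : SphereValued u₂ U) (hz : z ∈ U) :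
    heatOp (fun y => ∑ i : Fin k, (u₁ y i - u₂ y i) ^ 2) z
      ≤ (gradSq u₁ z + gradSq u₂ z) * ∑ i : Fin k, (u₁ z i - u₂ z i) ^ 2 := by
  have hc₁ := fun i => smoothOn_component hu₁ i
  have hc₂ := fun i => smoothOn_component hu₂ i
  refine (heatOp_sum_sq_le Finset.univ (f := fun i y => u₁ y i - u₂ y i) hU
    (fun i => (hc₁ i).sub (hc₂ i)) hz).trans (le_of_eq ?_)
  have e1 : ∀ i : Fin k, 2 * (u₁ z i - u₂ z i) * heatOp (fun y => u₁ y i - u₂ y i) z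
      = (gradSq u₁ z + gradSq u₂ z) * (u₁ z i - u₂ z i) ^ 2
        + (gradSq u₁ z - gradSq u₂ z) * (u₁ z i ^ 2 - u₂ z i ^ 2) := by
    intro i
    rw [heatOp_sub hU (hc₁ i) (hc₂ i) hz, h₁.heatOp_eq hz, h₂.heatOp_eq hz]
    ring
  simp only [e1, Finset.sum_add_distrib, ← Finset.mul_sum, Finset.sum_sub_distrib, hs₁ z hz,
    hs₂ z hz]
  ring

end SphereFlow

section WeightedInequality

variable {n : ℕ} {U : Set (Sp n × ℝ)} {f g q Ψ : Sp n × ℝ → ℝ} {K : Set (Sp n)} {t t₀ t₁ : ℝ} {x : Sp n}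

lemma dirDeriv_eq_zero_off (hU : IsOpen U) (hK : IsCompact K)
    (h0 : ∀ z ∈ U, z.1 ∉ K → f z = 0) (v : Sp n × ℝ) :
    ∀ z ∈ U, z.1 ∉ K → dirDeriv v f z = 0 := by
  intro z hz hzK
  have hV : IsOpen (U ∩ {z : Sp n × ℝ | z.1 ∉ K}) :=
    hU.inter (hK.isClosed.isOpen_compl.preimage continuous_fst)
  rw [dirDeriv_congr hV ⟨hz, hzK⟩ (g := fun _ => (0 : ℝ)) (fun y hy => h0 y hy.1 hy.2),
    dirDeriv_const]

lemma fderiv_slice (hf : DifferentiableAt ℝ f (x, t)) (e : Sp n) :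
    fderiv ℝ (fun y => f (y, t)) x e = dirDeriv (e, 0) f (x, t) := by
  have h1 : HasFDerivAt (fun y : Sp n => (y, t)) (ContinuousLinearMap.inl ℝ (Sp n) ℝ) x :=
    hasFDerivAt_prodMk_left x t
  have h2 := hf.hasFDerivAt.comp x h1
  rw [dirDeriv]
  have : fderiv ℝ (fun y => f (y, t)) x = _ := h2.fderiv
  rw [this]
  simp

lemma hasDerivAt_slice (hf : DifferentiableAt ℝ f (x, t)) :
    HasDerivAt (fun s => f (x, s)) (dirDeriv (tdir n) f (x, t)) t := by
  have h1 : HasDerivAt (fun s : ℝ => (x, s)) (tdir n) t :=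
    (hasDerivAt_const t x).prodMk (hasDerivAt_id t)
  exact hf.hasFDerivAt.comp_hasDerivAt t h1

lemma SmoothOn.continuous_slice (hU : IsOpen U) (ht : ∀ x, (x, t) ∈ U) (hf : SmoothOn f U) :
    Continuous fun x => f (x, t) :=
  continuous_iff_continuousAt.2 fun x =>
    (hf.differentiableAt hU (ht x)).continuousAt.comp
      (f := fun y : Sp n => (y, t)) (by fun_prop)

lemma SmoothOn.differentiable_slice (hU : IsOpen U) (ht : ∀ x, (x, t) ∈ U) (hf : SmoothOn f U) :
    Differentiable ℝ fun x => f (x, t) := fun x =>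
  (hf.differentiableAt hU (ht x)).comp x
    (f := fun y : Sp n => (y, t)) (by fun_prop)

lemma integrable_slice (hU : IsOpen U) (ht : ∀ x, (x, t) ∈ U) (hf : SmoothOn f U)
    (hK : IsCompact K) (h0 : ∀ z ∈ U, z.1 ∉ K → f z = 0) :
    Integrable fun x => f (x, t) :=
  (hf.continuous_slice hU ht).integrable_of_hasCompactSupport
    (HasCompactSupport.intro hK fun x hx => h0 (x, t) (ht x) hx)

lemma integral_slice_mul_dirDeriv (hU : IsOpen U) (ht : ∀ x, (x, t) ∈ U) (hf : SmoothOn f U)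
    (hg : SmoothOn g U) (hK : IsCompact K) (h0 : ∀ z ∈ U, z.1 ∉ K → f z = 0) (α : Fin n) :
    ∫ x, f (x, t) * dirDeriv (sdir n α) g (x, t)
      = -∫ x, dirDeriv (sdir n α) f (x, t) * g (x, t) := by
  have hf' := hf.dirDeriv hU (sdir n α)
  have hg' := hg.dirDeriv hU (sdir n α)
  have hd := dirDeriv_eq_zero_off hU hK h0 (sdir n α)
  have e1 : ∀ x, fderiv ℝ (fun y => f (y, t)) x (EuclideanSpace.single α 1)
      = dirDeriv (sdir n α) f (x, t) := fun x => fderiv_slice (hf.differentiableAt hU (ht x)) _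
  have e2 : ∀ x, fderiv ℝ (fun y => g (y, t)) x (EuclideanSpace.single α 1)
      = dirDeriv (sdir n α) g (x, t) := fun x => fderiv_slice (hg.differentiableAt hU (ht x)) _
  simp only [← e1, ← e2]
  apply integral_mul_fderiv_eq_neg_fderiv_mul_of_integrable
  · simp only [e1]
    exact integrable_slice hU ht (hf'.mul hg) hK fun z hz hzK => by simp [hd z hz hzK]
  · simp only [e2]
    exact integrable_slice hU ht (hf.mul hg') hK fun z hz hzK => by simp [h0 z hz hzK]
  · exact integrable_slice hU ht (hf.mul hg) hK fun z hz hzK => by simp [h0 z hz hzK]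
  · exact fun x _ => hf.differentiable_slice hU ht x
  · exact fun x _ => hg.differentiable_slice hU ht x

lemma integral_slice_mul_spaceLap (hU : IsOpen U) (ht : ∀ x, (x, t) ∈ U) (hq : SmoothOn q U)
    (hΨ : SmoothOn Ψ U) (hK : IsCompact K) (h0 : ∀ z ∈ U, z.1 ∉ K → Ψ z = 0) :
    ∫ x, Ψ (x, t) * spaceLap q (x, t) = ∫ x, q (x, t) * spaceLap Ψ (x, t) := by
  have hd := fun α => dirDeriv_eq_zero_off hU hK h0 (sdir n α)
  have hdd := fun α => dirDeriv_eq_zero_off hU hK (hd α) (sdir n α)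
  have hq' := fun α => (hq.dirDeriv hU (sdir n α))
  have hq'' := fun α => (hq' α).dirDeriv hU (sdir n α)
  have hΨ' := fun α => (hΨ.dirDeriv hU (sdir n α))
  have hΨ'' := fun α => (hΨ' α).dirDeriv hU (sdir n α)
  simp only [spaceLap, Finset.mul_sum]
  rw [integral_finsetSum, integral_finsetSum]
  · refine Finset.sum_congr rfl fun α _ => ?_
    rw [integral_slice_mul_dirDeriv hU ht hΨ (hq' α) hK h0,
      integral_slice_mul_dirDeriv hU ht (hΨ' α) hq hK (hd α), neg_neg]
    exact integral_congr_ae (Filter.Eventually.of_forall fun x => mul_comm _ _)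
  · exact fun α _ => integrable_slice hU ht (hq.mul (hΨ'' α)) hK
      fun z hz hzK => by simp [hdd α z hz hzK]
  · exact fun α _ => integrable_slice hU ht (hΨ.mul (hq'' α)) hK
      fun z hz hzK => by simp [h0 z hz hzK]

lemma SmoothOn.integrableOn_cylinder (hK : IsCompact K) (hf : SmoothOn f U)
    (ht : ∀ x, ∀ t ∈ Icc t₀ t₁, (x, t) ∈ U) : IntegrableOn f (K ×ˢ Ioc t₀ t₁) :=
  ((hf.continuousOn.mono fun z hz => ht z.1 z.2 hz.2).integrableOn_compact
    (hK.prod isCompact_Icc)).mono_set (Set.prod_mono le_rfl Ioc_subset_Icc_self)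

/-- Testing a nonnegative subsolution of `∂ₜq ≤ Δq + a q` against a compactly supported weight
that is almost a supersolution of the backward equation. -/
lemma subsolution_integral_le (hU : IsOpen U) (hK : IsCompact K)
    (hle : t₀ ≤ t₁) (ht : ∀ x, ∀ t ∈ Icc t₀ t₁, (x, t) ∈ U)
    (hq : SmoothOn q U) (hΨ : SmoothOn Ψ U) (h0 : ∀ z ∈ U, z.1 ∉ K → Ψ z = 0)
    (hq0 : ∀ z ∈ U, 0 ≤ q z) (hΨ0 : ∀ z ∈ U, 0 ≤ Ψ z) (a : ℝ → ℝ) (C : ℝ)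
    (hsub : ∀ x ∈ K, ∀ t ∈ Icc t₀ t₁, heatOp q (x, t) ≤ a t * q (x, t))
    (hsup : ∀ x ∈ K, ∀ t ∈ Icc t₀ t₁,
      dirDeriv (tdir n) Ψ (x, t) + spaceLap Ψ (x, t) + a t * Ψ (x, t) ≤ C) :
    ∫ x in K, q (x, t₁) * Ψ (x, t₁)
      ≤ (∫ x in K, q (x, t₀) * Ψ (x, t₀)) + C * ∫ z in K ×ˢ Ioc t₀ t₁, q z := by
  have hP : SmoothOn (fun z => q z * Ψ z) U := hq.mul hΨ
  have hG := hP.dirDeriv hU (tdir n)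
  have hslice : ∀ {f : Sp n × ℝ → ℝ}, SmoothOn f U → ∀ t ∈ Icc t₀ t₁,
      IntegrableOn (fun x => f (x, t)) K := fun hf t ht' =>
    (hf.continuous_slice hU fun x => ht x t ht').continuousOn.integrableOn_compact hK
  have hGint := hG.integrableOn_cylinder hK ht
  have hqint := hq.integrableOn_cylinder hK ht
  have slice_difference : (∫ x in K, q (x, t₁) * Ψ (x, t₁)) - ∫ x in K, q (x, t₀) * Ψ (x, t₀)
      = ∫ z in K ×ˢ Ioc t₀ t₁, dirDeriv (tdir n) (fun z => q z * Ψ z) z := by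
    rw [← integral_sub (hslice hP t₁ ⟨hle, le_rfl⟩) (hslice hP t₀ ⟨le_rfl, hle⟩),
      Measure.volume_eq_prod, setIntegral_prod _ hGint]
    refine integral_congr_ae (Filter.Eventually.of_forall fun x => ?_)
    simp only
    rw [← intervalIntegral.integral_of_le hle]
    refine (intervalIntegral.integral_eq_sub_of_hasDerivAt
      (f := fun s => q (x, s) * Ψ (x, s)) (fun s hs => ?_) ?_).symm
    · rw [uIcc_of_le hle] at hs
      exact hasDerivAt_slice (f := fun z => q z * Ψ z) (hP.differentiableAt hU (ht x s hs))
    · apply ContinuousOn.intervalIntegrable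
      rw [uIcc_of_le hle]
      exact hG.continuousOn.comp (f := fun s : ℝ => (x, s)) (by fun_prop) fun s hs => ht x s hs
  have integrand_bound : ∫ z in K ×ˢ Ioc t₀ t₁, dirDeriv (tdir n) (fun z => q z * Ψ z) z
      ≤ ∫ z in K ×ˢ Ioc t₀ t₁, C * q z := by
    have hCq := hqint.const_mul C
    rw [Measure.volume_eq_prod, setIntegral_prod _ hGint, setIntegral_prod _ hCq]
    replace hGint : Integrable (dirDeriv (tdir n) fun z => q z * Ψ z)
        ((volume.restrict K).prod (volume.restrict (Ioc t₀ t₁))) := by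
      rw [Measure.prod_restrict]; exact hGint
    replace hCq : Integrable (fun z => C * q z)
        ((volume.restrict K).prod (volume.restrict (Ioc t₀ t₁))) := by
      rw [Measure.prod_restrict]; exact hCq
    rw [integral_integral_swap (f := fun x s => dirDeriv (tdir n) (fun z => q z * Ψ z) (x, s)) hGint,
      integral_integral_swap (f := fun x s => C * q (x, s)) hCq]
    refine setIntegral_mono_on hGint.integral_prod_right hCq.integral_prod_right
      measurableSet_Ioc fun s hs => ?_
    have hs' : s ∈ Icc t₀ t₁ := Ioc_subset_Icc_self hs
    have hsU := fun x => ht x s hs'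
    have hLΨ := hΨ.spaceLap hU
    have hLq := hq.spaceLap hU
    have hΨt := hΨ.dirDeriv hU (tdir n)
    have hLΨ0 : ∀ z ∈ U, z.1 ∉ K → spaceLap Ψ z = 0 := fun z hz hzK =>
      Finset.sum_eq_zero fun α _ => dirDeriv_eq_zero_off hU hK
        (dirDeriv_eq_zero_off hU hK h0 (sdir n α)) (sdir n α) z hz hzK
    have swap : ∫ x in K, Ψ (x, s) * spaceLap q (x, s)
        = ∫ x in K, q (x, s) * spaceLap Ψ (x, s) := by
      rw [setIntegral_eq_integral_of_forall_compl_eq_zero fun x hx => by simp [h0 _ (hsU x) hx],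
        setIntegral_eq_integral_of_forall_compl_eq_zero fun x hx => by simp [hLΨ0 _ (hsU x) hx]]
      exact integral_slice_mul_spaceLap hU hsU hq hΨ hK h0
    calc ∫ x in K, dirDeriv (tdir n) (fun z => q z * Ψ z) (x, s)
        ≤ ∫ x in K, (q (x, s) * (dirDeriv (tdir n) Ψ (x, s) + a s * Ψ (x, s))
            + Ψ (x, s) * spaceLap q (x, s)) := by
          refine setIntegral_mono_on (hslice hG s hs')
            (hslice ((hq.mul (hΨt.add (contDiffOn_const.mul hΨ))).add (hΨ.mul hLq)) s hs')
            hK.measurableSet fun x hx => ?_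
          rw [dirDeriv_mul (hq.differentiableAt hU (hsU x)) (hΨ.differentiableAt hU (hsU x))]
          have h1 := mul_le_mul_of_nonneg_left (hsub x hx s hs') (hΨ0 _ (hsU x))
          rw [heatOp] at h1
          linarith
      _ = ∫ x in K, q (x, s) * (dirDeriv (tdir n) Ψ (x, s) + spaceLap Ψ (x, s)
            + a s * Ψ (x, s)) := by
          rw [integral_add (hslice (hq.mul (hΨt.add (contDiffOn_const.mul hΨ))) s hs')
            (hslice (hΨ.mul hLq) s hs'), swap,
            ← integral_add (hslice (hq.mul (hΨt.add (contDiffOn_const.mul hΨ))) s hs')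
            (hslice (hq.mul hLΨ) s hs')]
          refine integral_congr_ae (Filter.Eventually.of_forall fun x => ?_)
          simp only
          ring
      _ ≤ ∫ x in K, C * q (x, s) := by
          refine setIntegral_mono_on
            (hslice (hq.mul ((hΨt.add hLΨ).add (contDiffOn_const.mul hΨ))) s hs')
            ((hslice hq s hs').const_mul C) hK.measurableSet fun x hx => ?_
          rw [mul_comm C]
          exact mul_le_mul_of_nonneg_left (hsup x hx s hs') (hq0 _ (hsU x))
  rw [integral_const_mul] at integrand_bound
  linarith

end WeightedInequality

section TestFunctions

variable {n : ℕ}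

lemma dirDeriv_comp_scalar {E : Type*} [NormedAddCommGroup E] [NormedSpace ℝ E] {f : E → ℝ} {z : E}
    {h : ℝ → ℝ} {h' : ℝ} (hh : HasDerivAt h h' (f z)) (hf : DifferentiableAt ℝ f z) (v : E) :
    dirDeriv v (fun y => h (f y)) z = h' * dirDeriv v f z := by
  have h1 : fderiv ℝ (fun y => h (f y)) z = _ := (hh.comp_hasFDerivAt z hf.hasFDerivAt).fderiv
  rw [dirDeriv, h1]
  simp [dirDeriv]

lemma dirDeriv_rescale {g : Sp n → ℝ} (hg : ContDiff ℝ (⊤ : ℕ∞) g) (c : ℝ) (x₁ : Sp n)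
    (v z : Sp n × ℝ) :
    dirDeriv v (fun z : Sp n × ℝ => g (c • (z.1 - x₁))) z
      = c * dirDeriv v.1 g (c • (z.1 - x₁)) := by
  have h1 : HasFDerivAt (fun z : Sp n × ℝ => c • (z.1 - x₁))
      (c • ContinuousLinearMap.fst ℝ (Sp n) ℝ) z :=
    (hasFDerivAt_fst.sub_const x₁).const_smul c
  have h2 := ((hg.differentiable (by simp)).differentiableAt
    (x := c • (z.1 - x₁))).hasFDerivAt.comp z h1
  have h3 : fderiv ℝ (fun z : Sp n × ℝ => g (c • (z.1 - x₁))) z = _ := h2.fderiv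
  rw [dirDeriv, h3]
  simp [dirDeriv]

/-- Smooth spatial cutoffs on spacetime, with the expected scaling of their derivatives. -/
lemma exists_cutoff (n : ℕ) : ∃ C : ℝ, 0 ≤ C ∧ ∀ (x₁ : Sp n) (s : ℝ), 0 < s →
    ∃ φ : Sp n × ℝ → ℝ, ContDiff ℝ (⊤ : ℕ∞) φ ∧ (∀ z, 0 ≤ φ z) ∧ (∀ z, φ z ≤ 1) ∧
      (∀ z, dist z.1 x₁ ≤ s / 2 → φ z = 1) ∧ (∀ z, z.1 ∉ closedBall x₁ s → φ z = 0) ∧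
      (∀ z, dirDeriv (tdir n) φ z = 0) ∧
      (∀ α z, |dirDeriv (sdir n α) φ z| ≤ C / s) ∧
      (∀ z, |spaceLap φ z| ≤ C / s ^ 2) := by
  let b : ContDiffBump (0 : Sp n) := ⟨1 / 2, 1, by norm_num, by norm_num⟩
  have hb : ContDiff ℝ (⊤ : ℕ∞) b := b.contDiff
  have hbs : HasCompactSupport b := b.hasCompactSupport
  have hb' : ∀ e : Sp n, ContDiff ℝ (⊤ : ℕ∞) (dirDeriv e b) := fun e =>
    contDiffOn_univ.1 (SmoothOn.dirDeriv isOpen_univ (contDiffOn_univ.2 hb) e)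
  have hb'' : ∀ e : Sp n, ContDiff ℝ (⊤ : ℕ∞) (dirDeriv e (dirDeriv e b)) := fun e =>
    contDiffOn_univ.1 (SmoothOn.dirDeriv isOpen_univ (contDiffOn_univ.2 (hb' e)) e)
  have hbs' : ∀ e : Sp n, HasCompactSupport (dirDeriv e b) := fun e => hbs.fderiv_apply ℝ e
  have hbs'' : ∀ e : Sp n, HasCompactSupport (dirDeriv e (dirDeriv e b)) := fun e =>
    (hbs' e).fderiv_apply ℝ e
  choose B₁ hB₁ using fun α : Fin n =>
    (hb' (EuclideanSpace.single α 1)).continuous.bounded_above_of_compact_support (hbs' _)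
  choose B₂ hB₂ using fun α : Fin n =>
    (hb'' (EuclideanSpace.single α 1)).continuous.bounded_above_of_compact_support (hbs'' _)
  have hB₁0 : ∀ α, 0 ≤ B₁ α := fun α => (norm_nonneg _).trans (hB₁ α 0)
  have hB₂0 : ∀ α, 0 ≤ B₂ α := fun α => (norm_nonneg _).trans (hB₂ α 0)
  have hs₁ : 0 ≤ ∑ α, B₁ α := Finset.sum_nonneg fun α _ => hB₁0 α
  have hs₂ : 0 ≤ ∑ α, B₂ α := Finset.sum_nonneg fun α _ => hB₂0 α
  refine ⟨∑ α, B₁ α + ∑ α, B₂ α, add_nonneg hs₁ hs₂, fun x₁ s hs => ?_⟩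
  have hD : ∀ v, dirDeriv v (fun z : Sp n × ℝ => b (s⁻¹ • (z.1 - x₁)))
      = fun z => s⁻¹ * dirDeriv v.1 b (s⁻¹ • (z.1 - x₁)) := fun v => by
    funext z
    exact dirDeriv_rescale hb _ _ _ _
  have hnorm : ∀ x : Sp n, ‖s⁻¹ • (x - x₁)‖ = dist x x₁ / s := fun x => by
    rw [norm_smul, norm_inv, Real.norm_of_nonneg hs.le, dist_eq_norm]
    ring
  refine ⟨fun z => b (s⁻¹ • (z.1 - x₁)), ?_, fun z => b.nonneg, fun z => b.le_one, ?_, ?_, ?_,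
    ?_, ?_⟩
  · exact hb.comp (by fun_prop)
  · intro z hz
    apply b.one_of_mem_closedBall
    rw [mem_closedBall, dist_zero_right, hnorm]
    change _ ≤ (1 / 2 : ℝ)
    rw [div_le_iff₀ hs]
    linarith
  · intro z hz
    apply b.zero_of_le_dist
    rw [dist_zero_right, hnorm]
    change (1 : ℝ) ≤ _
    rw [le_div_iff₀ hs]
    rw [mem_closedBall, not_le] at hz
    linarith
  · intro z
    rw [hD]
    simp [tdir, dirDeriv]
  · intro α z
    rw [hD]
    simp only [abs_mul, abs_inv, abs_of_pos hs]
    rw [inv_mul_eq_div]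
    gcongr
    exact (hB₁ α _).trans ((Finset.single_le_sum (fun i _ => hB₁0 i) (Finset.mem_univ α)).trans
      (by linarith))
  · intro z
    have hDD : ∀ α, dirDeriv (sdir n α)
        (dirDeriv (sdir n α) (fun z : Sp n × ℝ => b (s⁻¹ • (z.1 - x₁)))) z
        = s⁻¹ * (s⁻¹ * dirDeriv (EuclideanSpace.single α 1)
            (dirDeriv (EuclideanSpace.single α 1) b) (s⁻¹ • (z.1 - x₁))) := by
      intro α
      rw [hD]
      have hd : DifferentiableAt ℝ (fun z : Sp n × ℝ =>
          dirDeriv (EuclideanSpace.single α 1) b (s⁻¹ • (z.1 - x₁))) z :=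
        (((hb' _).comp (by fun_prop : ContDiff ℝ (⊤ : ℕ∞)
          fun z : Sp n × ℝ => s⁻¹ • (z.1 - x₁))).differentiable (by simp)).differentiableAt
      have := dirDeriv_mul (differentiableAt_const s⁻¹) hd (sdir n α)
      rw [dirDeriv_const, mul_zero, add_zero, dirDeriv_rescale (hb' _)] at this
      exact this
    simp only [spaceLap, hDD, ← Finset.mul_sum]
    rw [abs_mul, abs_mul, abs_inv, abs_of_pos hs, ← mul_assoc, ← mul_inv, ← pow_two,
      inv_mul_eq_div]
    gcongr
    refine (Finset.abs_sum_le_sum_abs _ _).trans ?_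
    refine (Finset.sum_le_sum fun α _ => hB₂ α _).trans ?_
    linarith

/-- The backward Gaussian with pole `(x₁, τ)`, up to a multiplicative constant. -/
def backGauss (x₁ : Sp n) (τ : ℝ) (z : Sp n × ℝ) : ℝ :=
  exp (-(n / 2) * log (τ - z.2) - (∑ i, (z.1 i - x₁ i) ^ 2) * (4 * (τ - z.2))⁻¹)

lemma backGauss_pos (x₁ : Sp n) (τ : ℝ) (z : Sp n × ℝ) : 0 < backGauss x₁ τ z := exp_pos _

lemma isOpen_snd_lt (τ : ℝ) : IsOpen {z : Sp n × ℝ | z.2 < τ} :=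
  isOpen_lt continuous_snd continuous_const

lemma smoothOn_backGauss (x₁ : Sp n) (τ : ℝ) : SmoothOn (backGauss x₁ τ) {z | z.2 < τ} := by
  have hl : ∀ z ∈ {z : Sp n × ℝ | z.2 < τ}, τ - z.2 ≠ 0 := fun z hz => (sub_pos.2 hz).ne'
  unfold backGauss
  refine ContDiffOn.exp (ContDiffOn.sub ?_ ?_)
  · refine contDiffOn_const.mul (ContDiffOn.log (by fun_prop) hl)
  · refine ContDiffOn.mul (by fun_prop) (ContDiffOn.inv (by fun_prop) fun z hz => ?_)
    exact mul_ne_zero four_ne_zero (hl z hz)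

lemma dirDeriv_sdir_coord (x₁ : Sp n) (z : Sp n × ℝ) (i α : Fin n) :
    dirDeriv (sdir n α) (fun z : Sp n × ℝ => z.1 i - x₁ i) z = if i = α then 1 else 0 := by
  have : HasFDerivAt (fun z : Sp n × ℝ => z.1 i - x₁ i)
      ((EuclideanSpace.proj i).comp (ContinuousLinearMap.fst ℝ (Sp n) ℝ)) z :=
    (((EuclideanSpace.proj i : Sp n →L[ℝ] ℝ).comp
      (ContinuousLinearMap.fst ℝ (Sp n) ℝ)).hasFDerivAt).sub_const _
  rw [dirDeriv, this.fderiv]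
  simp [sdir]

lemma dirDeriv_sdir_time (g : ℝ → ℝ) (z : Sp n × ℝ) (α : Fin n)
    (hg : DifferentiableAt ℝ g z.2) :
    dirDeriv (sdir n α) (fun z : Sp n × ℝ => g z.2) z = 0 := by
  have : HasFDerivAt (fun z : Sp n × ℝ => g z.2) _ z :=
    hg.hasFDerivAt.comp z (hasFDerivAt_snd (p := z))
  rw [dirDeriv, this.fderiv]
  simp [sdir]

lemma dirDeriv_sdir_backGauss (x₁ : Sp n) {τ : ℝ} {z : Sp n × ℝ} (hz : z.2 < τ) (α : Fin n) :
    dirDeriv (sdir n α) (backGauss x₁ τ) z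
      = -((z.1 α - x₁ α) * (2 * (τ - z.2))⁻¹) * backGauss x₁ τ z := by
  have hl : τ - z.2 ≠ 0 := (sub_pos.2 hz).ne'
  have d1 : DifferentiableAt ℝ (fun t => -((n : ℝ) / 2) * log (τ - t)) z.2 :=
    ((differentiableAt_id.const_sub τ).log hl).const_mul _
  have d2 : DifferentiableAt ℝ (fun t => (4 * (τ - t))⁻¹) z.2 :=
    ((differentiableAt_id.const_sub τ).const_mul 4).inv (mul_ne_zero four_ne_zero hl)
  have D1 : DifferentiableAt ℝ (fun z : Sp n × ℝ => -((n : ℝ) / 2) * log (τ - z.2)) z :=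
    d1.comp z differentiableAt_snd
  have D2 : DifferentiableAt ℝ (fun z : Sp n × ℝ => (4 * (τ - z.2))⁻¹) z :=
    DifferentiableAt.comp (g := fun t => (4 * (τ - t))⁻¹) z d2 differentiableAt_snd
  have D3 : DifferentiableAt ℝ (fun z : Sp n × ℝ => ∑ i, (z.1 i - x₁ i) ^ 2) z := by fun_prop
  have hN : dirDeriv (sdir n α) (fun z : Sp n × ℝ => ∑ i, (z.1 i - x₁ i) ^ 2) z
      = 2 * (z.1 α - x₁ α) := by
    rw [dirDeriv_sum _ (fun i _ => by fun_prop)]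
    have : ∀ i, dirDeriv (sdir n α) (fun z : Sp n × ℝ => (z.1 i - x₁ i) ^ 2) z
        = if i = α then 2 * (z.1 i - x₁ i) else 0 := by
      intro i
      rw [dirDeriv_sq (by fun_prop), dirDeriv_sdir_coord]
      split_ifs <;> ring
    simp [this]
  have h1 := dirDeriv_comp_scalar (Real.hasDerivAt_exp _) (D1.sub (D3.mul D2)) (sdir n α)
  refine h1.trans ?_
  have h2 := dirDeriv_sub D1 (D3.mul D2) (sdir n α)
  have h3 := dirDeriv_mul D3 D2 (sdir n α)
  have h4 := dirDeriv_sdir_time _ z α d1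
  have h5 := dirDeriv_sdir_time _ z α d2
  rw [h5, hN] at h3
  have h6 := h2.trans (congrArg₂ _ h4 h3)
  rw [mul_comm]
  refine congrArg₂ _ (h6.trans ?_) rfl
  field_simp
  ring

lemma dirDeriv_tdir_backGauss (x₁ : Sp n) {τ : ℝ} {z : Sp n × ℝ} (hz : z.2 < τ) :
    dirDeriv (tdir n) (backGauss x₁ τ) z
      = (n / 2 * (τ - z.2)⁻¹ - (∑ i, (z.1 i - x₁ i) ^ 2) * (4 * (τ - z.2) ^ 2)⁻¹)
        * backGauss x₁ τ z := by
  have hl : τ - z.2 ≠ 0 := (sub_pos.2 hz).ne'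
  have h0 : DifferentiableAt ℝ (backGauss x₁ τ) z :=
    (smoothOn_backGauss x₁ τ).differentiableAt (isOpen_snd_lt τ) hz
  have h1 := hasDerivAt_slice (x := z.1) (t := z.2) h0
  have hd : HasDerivAt (fun t => τ - t) (-1) z.2 := (hasDerivAt_id z.2).const_sub τ
  have h2 : HasDerivAt (fun s => backGauss x₁ τ (z.1, s)) _ z.2 :=
    (((hd.log hl).const_mul (-((n : ℝ) / 2))).sub
      (((hd.const_mul 4).inv (mul_ne_zero four_ne_zero hl)).const_mul
        (∑ i, (z.1 i - x₁ i) ^ 2))).exp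
  refine (h1.unique h2).trans ?_
  rw [mul_comm]
  refine congrArg₂ _ ?_ rfl
  field_simp

lemma dirDeriv_add_spaceLap_backGauss (x₁ : Sp n) {τ : ℝ} {z : Sp n × ℝ} (hz : z.2 < τ) :
    dirDeriv (tdir n) (backGauss x₁ τ) z + spaceLap (backGauss x₁ τ) z = 0 := by
  have hl : τ - z.2 ≠ 0 := (sub_pos.2 hz).ne'
  have hU := isOpen_snd_lt (n := n) τ
  have hΓ := (smoothOn_backGauss x₁ τ).differentiableAt hU hz
  have d2 : DifferentiableAt ℝ (fun t => (2 * (τ - t))⁻¹) z.2 :=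
    ((differentiableAt_id.const_sub τ).const_mul 2).inv (mul_ne_zero two_ne_zero hl)
  have D2 : DifferentiableAt ℝ (fun z : Sp n × ℝ => (2 * (τ - z.2))⁻¹) z :=
    DifferentiableAt.comp (g := fun t => (2 * (τ - t))⁻¹) z d2 differentiableAt_snd
  have key : ∀ α : Fin n, dirDeriv (sdir n α) (dirDeriv (sdir n α) (backGauss x₁ τ)) z
      = (-(2 * (τ - z.2))⁻¹ + (z.1 α - x₁ α) ^ 2 * (4 * (τ - z.2) ^ 2)⁻¹)
        * backGauss x₁ τ z := by
    intro α
    have DX : DifferentiableAt ℝ (fun z : Sp n × ℝ => z.1 α - x₁ α) z := by fun_prop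
    rw [dirDeriv_congr hU hz (fun y hy => dirDeriv_sdir_backGauss x₁ hy α),
      dirDeriv_mul (DX.fun_mul D2).fun_neg hΓ, dirDeriv_sdir_backGauss x₁ hz]
    have h3 : dirDeriv (sdir n α)
        (fun z : Sp n × ℝ => -((z.1 α - x₁ α) * (2 * (τ - z.2))⁻¹)) z = -(2 * (τ - z.2))⁻¹ := by
      rw [dirDeriv, fderiv_fun_neg]
      have h4 := dirDeriv_mul DX D2 (sdir n α)
      rw [dirDeriv_sdir_time _ z α d2, dirDeriv_sdir_coord] at h4
      rw [neg_apply]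
      refine congrArg Neg.neg (h4.trans ?_)
      simp
    rw [h3]
    field_simp
    ring
  rw [spaceLap, dirDeriv_tdir_backGauss x₁ hz]
  simp only [key, ← Finset.sum_mul, Finset.sum_add_distrib]
  rw [Finset.sum_const, Finset.card_univ, Fintype.card_fin, nsmul_eq_mul]
  field_simp
  ring

end TestFunctions

section MeanValue

variable {n : ℕ}

lemma sum_sq_eq_dist_sq (x y : Sp n) : ∑ i, (x i - y i) ^ 2 = dist x y ^ 2 := by
  rw [dist_eq_norm, EuclideanSpace.norm_sq_eq]
  simp

lemma abs_coord_sub_le (x y : Sp n) (i : Fin n) : |x i - y i| ≤ dist x y := by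
  apply abs_le_of_sq_le_sq _ dist_nonneg
  rw [← sum_sq_eq_dist_sq]
  exact Finset.single_le_sum (f := fun i => (x i - y i) ^ 2) (fun i _ => sq_nonneg _)
    (Finset.mem_univ i)

/-- The constant in the off-diagonal Gaussian bounds. -/
def gaussConst (n : ℕ) : ℝ := 8 * 32 ^ n * (n + 1).factorial

lemma gaussConst_pos (n : ℕ) : 0 < gaussConst n := by
  unfold gaussConst
  positivity

lemma pow_mul_exp_neg_le {y : ℝ} (hy : 0 ≤ y) (m : ℕ) : y ^ m * exp (-y) ≤ m.factorial := by
  have h := Real.pow_div_factorial_le_exp y hy m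
  rw [div_le_iff₀ (by positivity)] at h
  rw [exp_neg, ← div_eq_mul_inv, div_le_iff₀ (exp_pos _)]
  linarith

lemma backGauss_le_off_diagonal {x x₁ : Sp n} {t τ s : ℝ} (hs : 0 < s) (ht : t < τ)
    (hτ : τ - t ≤ 2 * s ^ 2) (hx : s / 2 ≤ dist x x₁) :
    backGauss x₁ τ (x, t) ≤
      32 ^ n * ((s ^ 2 / (16 * (τ - t))) ^ n * exp (-(s ^ 2 / (16 * (τ - t))))) / s ^ n := by
  have hl : 0 < τ - t := sub_pos.2 ht
  set l := τ - t with hldef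
  set y := s ^ 2 / (16 * l) with hy
  have hy0 : 0 < y := by positivity
  have hy1 : 1 ≤ 32 * y := by
    rw [hy, ← mul_div_assoc, le_div_iff₀ (by positivity)]
    linarith
  have hlog : log l = 2 * log s - log (16 * y) := by
    have : l = s ^ 2 / (16 * y) := by
      rw [hy]
      field_simp
    rw [this, log_div (by positivity) (by positivity), log_pow]
    push_cast
    ring
  have hlog2 : log (16 * y) ≤ log (32 * y) := log_le_log (by positivity) (by linarith)
  have hlog3 : 0 ≤ log (32 * y) := log_nonneg hy1
  have hN : y ≤ dist x x₁ ^ 2 * (4 * l)⁻¹ := by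
    rw [hy, ← div_eq_mul_inv, div_le_div_iff₀ (by positivity) (by positivity)]
    have : (s / 2) ^ 2 ≤ dist x x₁ ^ 2 := by gcongr
    nlinarith
  have hn : (0 : ℝ) ≤ n := n.cast_nonneg
  have h1 : backGauss x₁ τ (x, t) ≤ exp (-(n * log s) + n * log (32 * y) - y) := by
    unfold backGauss
    rw [sum_sq_eq_dist_sq]
    apply exp_le_exp.2
    simp only [← hldef, hlog]
    nlinarith
  refine h1.trans (le_of_eq ?_)
  rw [exp_sub, exp_add, exp_neg, exp_neg, exp_nat_mul, exp_nat_mul, exp_log hs,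
    exp_log (by positivity), mul_pow]
  field_simp

lemma backGauss_le_div {x x₁ : Sp n} {t τ s : ℝ} (hs : 0 < s) (ht : t < τ)
    (hτ : τ - t ≤ 2 * s ^ 2) (hx : s / 2 ≤ dist x x₁) :
    backGauss x₁ τ (x, t) ≤ gaussConst n / s ^ n := by
  refine (backGauss_le_off_diagonal hs ht hτ hx).trans ?_
  have hl : 0 < τ - t := sub_pos.2 ht
  refine div_le_div_of_nonneg_right ?_ (by positivity)
  rw [gaussConst, mul_comm 8, mul_assoc]
  refine mul_le_mul_of_nonneg_left ?_ (by positivity)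
  refine (pow_mul_exp_neg_le (by positivity) n).trans ?_
  have : (n.factorial : ℝ) ≤ (n + 1).factorial := by exact_mod_cast Nat.factorial_le n.le_succ
  nlinarith [(Nat.cast_nonneg (n + 1).factorial : (0 : ℝ) ≤ _)]

lemma abs_dirDeriv_backGauss_le {x x₁ : Sp n} {t τ s : ℝ} (hs : 0 < s) (ht : t < τ)
    (hτ : τ - t ≤ 2 * s ^ 2) (hx : s / 2 ≤ dist x x₁) (hx' : dist x x₁ ≤ s) (α : Fin n) :
    |dirDeriv (sdir n α) (backGauss x₁ τ) (x, t)| ≤ gaussConst n / s ^ n / s := by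
  have hl : 0 < τ - t := sub_pos.2 ht
  have h1 := backGauss_le_off_diagonal hs ht hτ hx
  have h0 : |dirDeriv (sdir n α) (backGauss x₁ τ) (x, t)|
      = |x α - x₁ α| * (2 * (τ - t))⁻¹ * backGauss x₁ τ (x, t) := by
    have hl' : 0 < (2 * (τ - t))⁻¹ := by positivity
    rw [dirDeriv_sdir_backGauss x₁ (z := (x, t)) ht α, abs_mul, abs_neg, abs_mul,
      abs_of_pos (backGauss_pos _ _ _), abs_of_pos hl']
  rw [h0]
  set y := s ^ 2 / (16 * (τ - t)) with hy
  have hy0 : 0 < y := by positivity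
  have h2 : |x α - x₁ α| * (2 * (τ - t))⁻¹ ≤ 8 * y / s := by
    calc |x α - x₁ α| * (2 * (τ - t))⁻¹ ≤ s * (2 * (τ - t))⁻¹ := by
          gcongr
          exact (abs_coord_sub_le _ _ _).trans hx'
      _ = 8 * y / s := by
          rw [hy]
          field_simp
          norm_num
  calc |x α - x₁ α| * (2 * (τ - t))⁻¹ * backGauss x₁ τ (x, t)
      ≤ 8 * y / s * (32 ^ n * (y ^ n * exp (-y)) / s ^ n) :=
        mul_le_mul h2 h1 (backGauss_pos _ _ _).le (by positivity)
    _ = 8 * 32 ^ n * (y ^ (n + 1) * exp (-y)) / s ^ n / s := by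
        rw [pow_succ]
        field_simp
    _ ≤ gaussConst n / s ^ n / s := by
        unfold gaussConst
        gcongr
        exact pow_mul_exp_neg_le hy0.le (n + 1)

lemma backGauss_le_of_time {x₁ : Sp n} {z : Sp n × ℝ} {τ s : ℝ} (hs : 0 < s)
    (hτ : s ^ 2 / 2 ≤ τ - z.2) :
    backGauss x₁ τ z ≤ gaussConst n / s ^ n := by
  have hl : 0 < τ - z.2 := lt_of_lt_of_le (by positivity) hτ
  have hn : (0 : ℝ) ≤ n := n.cast_nonneg
  have hlog : 2 * log s - log 2 ≤ log (τ - z.2) := by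
    have := log_le_log (by positivity) hτ
    rw [log_div (by positivity) (by norm_num), log_pow] at this
    exact_mod_cast this
  have hlog2 : 0 ≤ log 2 := log_nonneg (by norm_num)
  have hN : 0 ≤ (∑ i, (z.1 i - x₁ i) ^ 2) * (4 * (τ - z.2))⁻¹ := by positivity
  have h1 : backGauss x₁ τ z ≤ exp (-(n * log s) + n * log 2) := by
    unfold backGauss
    apply exp_le_exp.2
    nlinarith
  refine h1.trans ?_
  rw [exp_add, exp_neg, exp_nat_mul, exp_nat_mul, exp_log hs, exp_log (by norm_num),
    inv_mul_eq_div]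
  gcongr
  have h3 : (2 : ℝ) ^ n ≤ 32 ^ n := by gcongr; norm_num
  have h4 : (1 : ℝ) ≤ (n + 1).factorial := by exact_mod_cast Nat.succ_le_of_lt (Nat.factorial_pos _)
  rw [gaussConst]
  have h5 : (0 : ℝ) < 32 ^ n := by positivity
  nlinarith

lemma backGauss_terminal (x x₁ : Sp n) (t : ℝ) {c : ℝ} (hc : 0 < c) :
    backGauss x₁ (t + (4 * c ^ 2)⁻¹) (x, t) = 2 ^ n * (c ^ n * exp (-‖c • (x₁ - x)‖ ^ 2)) := by
  unfold backGauss
  rw [sum_sq_eq_dist_sq, add_sub_cancel_left, log_inv, log_mul (by norm_num) (by positivity),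
    log_pow, norm_smul, Real.norm_of_nonneg hc.le, ← dist_eq_norm, dist_comm x₁]
  have h4 : log 4 = 2 * log 2 := by
    rw [show (4 : ℝ) = 2 ^ 2 by norm_num, log_pow]
    norm_num
  rw [h4]
  have : -((n : ℝ) / 2) * -(2 * log 2 + (2 : ℕ) * log c)
      - dist x x₁ ^ 2 * (4 * (4 * c ^ 2)⁻¹)⁻¹
      = n * log 2 + n * log c + -(c * dist x x₁) ^ 2 := by
    push_cast
    field_simp
    ring
  rw [this, exp_add, exp_add, exp_nat_mul, exp_nat_mul, exp_log (by norm_num), exp_log hc]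
  ring

lemma tendsto_gaussian_average {g : Sp n → ℝ} (hg : Integrable g) {x₁ : Sp n}
    (hgc : ContinuousAt g x₁) :
    Filter.Tendsto (fun c : ℝ => ∫ x, c ^ n * exp (-‖c • (x₁ - x)‖ ^ 2) * g x) Filter.atTop
      (nhds (π ^ ((n : ℝ) / 2) * g x₁)) := by
  set κ : ℝ := π ^ ((n : ℝ) / 2) with hκ
  have hκ0 : 0 < κ := by positivity
  have hint : ∫ x : Sp n, exp (-‖x‖ ^ 2) = κ := by
    have := GaussianFourier.integral_rexp_neg_mul_sq_norm (V := Sp n) one_pos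
    simpa using this
  have hdecay : Filter.Tendsto (fun x : Sp n =>
      ‖x‖ ^ Module.finrank ℝ (Sp n) * (κ⁻¹ * exp (-‖x‖ ^ 2))) (Bornology.cobounded (Sp n))
      (nhds 0) := by
    have h1 : Filter.Tendsto (fun r : ℝ => κ⁻¹ * (r ^ Module.finrank ℝ (Sp n) * exp (-r)))
        Filter.atTop (nhds 0) := by
      simpa using (Real.tendsto_pow_mul_exp_neg_atTop_nhds_zero
        (Module.finrank ℝ (Sp n))).const_mul κ⁻¹
    have h2 : Filter.Tendsto (fun r : ℝ => r ^ Module.finrank ℝ (Sp n) * (κ⁻¹ * exp (-r ^ 2)))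
        Filter.atTop (nhds 0) := by
      refine squeeze_zero' ?_ ?_ h1
      · filter_upwards [Filter.eventually_ge_atTop 0] with r hr
        positivity
      · filter_upwards [Filter.eventually_ge_atTop 1] with r hr
        rw [mul_left_comm]
        gcongr
        nlinarith
    exact h2.comp tendsto_norm_cobounded_atTop
  have h := tendsto_integral_comp_smul_smul_of_integrable' (μ := (volume : Measure (Sp n)))
    (φ := fun x => κ⁻¹ * exp (-‖x‖ ^ 2)) (fun x => by positivity)
    (by rw [integral_const_mul, hint, inv_mul_cancel₀ hκ0.ne']) hdecay hg hgc
  have h' := h.const_mul κ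
  refine h'.congr fun c => ?_
  rw [← integral_const_mul]
  refine integral_congr_ae (.of_forall fun x => ?_)
  simp only [finrank_euclideanSpace, Fintype.card_fin, smul_eq_mul]
  field_simp

end MeanValue

section MeanValueInequality

variable {n : ℕ}

lemma dirDeriv_sdir_eq_zero_of_dist_lt {φ : Sp n × ℝ → ℝ} {x₁ : Sp n} {ρ : ℝ}
    (h1 : ∀ z : Sp n × ℝ, dist z.1 x₁ ≤ ρ → φ z = 1) {z : Sp n × ℝ} (hz : dist z.1 x₁ < ρ) :
    (∀ α, dirDeriv (sdir n α) φ z = 0) ∧ spaceLap φ z = 0 := by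
  have hV : IsOpen {z : Sp n × ℝ | dist z.1 x₁ < ρ} :=
    isOpen_lt (by fun_prop) continuous_const
  have h2 : ∀ y ∈ {z : Sp n × ℝ | dist z.1 x₁ < ρ}, ∀ α, dirDeriv (sdir n α) φ y = 0 := by
    intro y hy α
    rw [dirDeriv_congr hV hy (g := fun _ => (1 : ℝ)) (fun w hw => h1 w (le_of_lt hw)),
      dirDeriv_const]
  refine ⟨h2 z hz, Finset.sum_eq_zero fun α _ => ?_⟩
  rw [dirDeriv_congr hV hz (g := fun _ => (0 : ℝ)) (fun w hw => h2 w hw α), dirDeriv_const]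

/-- A compactly supported weight with Gaussian profile is almost a backward supersolution. -/
lemma backward_op_weight {U : Set (Sp n × ℝ)} (hU : IsOpen U) {m φ Γ : Sp n × ℝ → ℝ} {b : ℝ}
    (hm : SmoothOn m U) (hφ : SmoothOn φ U) (hΓ : SmoothOn Γ U) {z : Sp n × ℝ} (hz : z ∈ U)
    (hmt : dirDeriv (tdir n) m z = -b * m z)
    (hms : ∀ y ∈ U, ∀ α, dirDeriv (sdir n α) m y = 0) (hφt : dirDeriv (tdir n) φ z = 0)
    (hΓ0 : dirDeriv (tdir n) Γ z + spaceLap Γ z = 0) :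
    dirDeriv (tdir n) (fun y => m y * (φ y * Γ y)) z + spaceLap (fun y => m y * (φ y * Γ y)) z
      + b * (m z * (φ z * Γ z))
      = m z * (Γ z * spaceLap φ z
        + 2 * ∑ α, dirDeriv (sdir n α) φ z * dirDeriv (sdir n α) Γ z) := by
  have hP : SmoothOn (fun y => φ y * Γ y) U := hφ.mul hΓ
  have hmL : spaceLap m z = 0 := Finset.sum_eq_zero fun α _ => by
    rw [dirDeriv_congr hU hz (g := fun _ => (0 : ℝ)) (fun w hw => hms w hw α), dirDeriv_const]
  rw [dirDeriv_mul (hm.differentiableAt hU hz) (hP.differentiableAt hU hz),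
    dirDeriv_mul (hφ.differentiableAt hU hz) (hΓ.differentiableAt hU hz),
    spaceLap_mul hU hm hP hz, spaceLap_mul hU hφ hΓ hz, hmt, hφt, hmL]
  simp only [hms z hz, zero_mul, Finset.sum_const_zero]
  linear_combination m z * φ z * hΓ0

/-- Local mean value inequality for nonnegative subsolutions of the heat equation. -/
lemma exists_mean_value_const (n : ℕ) : ∃ C : ℝ, 0 < C ∧ ∀ (U : Set (Sp n × ℝ)), IsOpen U →
    ∀ q : Sp n × ℝ → ℝ, SmoothOn q U → (∀ z ∈ U, 0 ≤ q z) →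
    ∀ (x₁ : Sp n) (t₁ s : ℝ), 0 < s → (∀ x, ∀ t ∈ Icc (t₁ - s ^ 2) t₁, (x, t) ∈ U) →
    (∀ x ∈ closedBall x₁ s, ∀ t ∈ Icc (t₁ - s ^ 2) t₁,
      heatOp q (x, t) ≤ 8 / s ^ 2 * q (x, t)) →
    q (x₁, t₁) ≤ C / s ^ (n + 2) * ∫ z in pcyl (x₁, t₁) s, q z := by
  obtain ⟨B, hB0, hB⟩ := exists_cutoff n
  set M := gaussConst n with hM
  have hM0 : 0 < M := gaussConst_pos n
  set C₁ : ℝ := exp 8 * (B * M + 2 * n * B * M) with hC₁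
  have hC₁0 : 0 ≤ C₁ := by positivity
  refine ⟨2 * exp 8 * M + C₁, by positivity, ?_⟩
  intro U hU q hq hq0 x₁ t₁ s hs hUs hsub
  obtain ⟨φ, hφs, hφ0, hφ1, hφone, hφzero, hφt, hφD, hφL⟩ := hB x₁ s hs
  set K := closedBall x₁ s with hK
  have hKc : IsCompact K := isCompact_closedBall x₁ s
  set I := ∫ z in pcyl (x₁, t₁) s, q z with hI
  have hs2 : 0 < s ^ 2 := by positivity
  have hslice : ∀ t ∈ Icc (t₁ - s ^ 2) t₁, IntegrableOn (fun x => q (x, t)) K := fun t ht =>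
    (hq.continuous_slice hU fun x => hUs x t ht).continuousOn.integrableOn_compact hKc
  have hqI : IntegrableOn q (K ×ˢ Ioc (t₁ - s ^ 2) t₁) := hq.integrableOn_cylinder hKc hUs
  have hqnn : ∀ᵐ z ∂(volume.restrict (K ×ˢ Ioc (t₁ - s ^ 2) t₁)), 0 ≤ q z :=
    (ae_restrict_mem (hKc.measurableSet.prod measurableSet_Ioc)).mono fun z hz =>
      hq0 z (hUs z.1 z.2 (Ioc_subset_Icc_self hz.2))
  -- the weighted average at the terminal time
  have main : ∀ c : ℝ, 0 < c → (4 * c ^ 2)⁻¹ ≤ s ^ 2 →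
      ∫ x in K, q (x, t₁) * (φ (x, t₁) * backGauss x₁ (t₁ + (4 * c ^ 2)⁻¹) (x, t₁))
        ≤ (2 * exp 8 * M + C₁) / s ^ (n + 2) * I := by
    intro c hc hcs
    set τ := t₁ + (4 * c ^ 2)⁻¹ with hτ
    have hτ1 : t₁ < τ := by
      have : 0 < (4 * c ^ 2)⁻¹ := by positivity
      linarith
    set m : Sp n × ℝ → ℝ := fun z => exp (8 / s ^ 2 * (t₁ - z.2)) with hm
    have hms : ContDiff ℝ (⊤ : ℕ∞) m := by
      rw [hm]
      fun_prop
    set Γ := backGauss x₁ τ with hΓ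
    set U' := U ∩ {z : Sp n × ℝ | z.2 < τ} with hU'
    have hU'o : IsOpen U' := hU.inter (isOpen_snd_lt τ)
    have hΓs : SmoothOn Γ U' := (smoothOn_backGauss x₁ τ).mono inter_subset_right
    have hmem : ∀ x, ∀ t ∈ Icc (t₁ - s ^ 2) t₁, (x, t) ∈ U' := fun x t ht =>
      ⟨hUs x t ht, lt_of_le_of_lt ht.2 hτ1⟩
    have hm_le : ∀ x, ∀ t ∈ Icc (t₁ - s ^ 2) t₁, m (x, t) ≤ exp 8 := by
      intro x t ht
      apply exp_le_exp.2
      change 8 / s ^ 2 * (t₁ - t) ≤ 8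
      rw [div_mul_eq_mul_div, div_le_iff₀ hs2]
      linarith [ht.1]
    have hmD : ∀ y : Sp n × ℝ, HasDerivAt (fun t => exp (8 / s ^ 2 * (t₁ - t)))
        (-(8 / s ^ 2) * m y) y.2 := by
      intro y
      have := ((((hasDerivAt_id y.2).const_sub t₁).const_mul (8 / s ^ 2))).exp
      refine this.congr_deriv ?_
      simp only [hm, id]
      ring
    have hmt : ∀ y : Sp n × ℝ, dirDeriv (tdir n) m y = -(8 / s ^ 2) * m y := by
      intro y
      have h1 := hasDerivAt_slice (x := y.1) (t := y.2) (f := m)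
        (hms.differentiable (by simp)).differentiableAt
      exact h1.unique (hmD y)
    have hms0 : ∀ (y : Sp n × ℝ) α, dirDeriv (sdir n α) m y = 0 := fun y α =>
      dirDeriv_sdir_time (fun t => exp (8 / s ^ 2 * (t₁ - t))) y α (hmD y).differentiableAt
    have hsup : ∀ x ∈ K, ∀ t ∈ Icc (t₁ - s ^ 2) t₁,
        dirDeriv (tdir n) (fun y => m y * (φ y * Γ y)) (x, t)
          + spaceLap (fun y => m y * (φ y * Γ y)) (x, t)
          + 8 / s ^ 2 * (m (x, t) * (φ (x, t) * Γ (x, t))) ≤ C₁ / s ^ (n + 2) := by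
      intro x hx t ht
      have htτ : t < τ := lt_of_le_of_lt ht.2 hτ1
      rw [backward_op_weight hU'o hms.contDiffOn hφs.contDiffOn hΓs (hmem x t ht) (hmt _)
        (fun y _ => hms0 y) (hφt _) (dirDeriv_add_spaceLap_backGauss x₁ htτ)]
      by_cases hd : dist x x₁ < s / 2
      · obtain ⟨e1, e2⟩ := dirDeriv_sdir_eq_zero_of_dist_lt hφone (z := (x, t)) hd
        simp only [e1, e2, mul_zero, zero_mul, Finset.sum_const_zero, add_zero]
        positivity
      · have hd' : s / 2 ≤ dist x x₁ := not_lt.1 hd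
        have hτt : τ - t ≤ 2 * s ^ 2 := by linarith [ht.1]
        have b1 : Γ (x, t) ≤ M / s ^ n := backGauss_le_div hs htτ hτt hd'
        have b2 : ∀ α, |dirDeriv (sdir n α) Γ (x, t)| ≤ M / s ^ n / s := fun α =>
          abs_dirDeriv_backGauss_le hs htτ hτt hd' hx α
        have b3 : Γ (x, t) * spaceLap φ (x, t) ≤ M / s ^ n * (B / s ^ 2) := by
          refine (mul_le_mul_of_nonneg_left (le_abs_self _) (backGauss_pos _ _ _).le).trans ?_
          exact mul_le_mul b1 (hφL _) (abs_nonneg _) (by positivity)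
        have b4 : ∑ α, dirDeriv (sdir n α) φ (x, t) * dirDeriv (sdir n α) Γ (x, t)
            ≤ n * (B / s * (M / s ^ n / s)) := by
          have : ∑ α : Fin n, dirDeriv (sdir n α) φ (x, t) * dirDeriv (sdir n α) Γ (x, t)
              ≤ ∑ _α : Fin n, B / s * (M / s ^ n / s) := by
            refine Finset.sum_le_sum fun α _ => (le_abs_self _).trans ?_
            rw [abs_mul]
            exact mul_le_mul (hφD α _) (b2 α) (abs_nonneg _) (by positivity)
          simpa using this
        calc m (x, t) * (Γ (x, t) * spaceLap φ (x, t)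
              + 2 * ∑ α, dirDeriv (sdir n α) φ (x, t) * dirDeriv (sdir n α) Γ (x, t))
            ≤ m (x, t) * (M / s ^ n * (B / s ^ 2) + 2 * (n * (B / s * (M / s ^ n / s)))) := by
              refine mul_le_mul_of_nonneg_left ?_ (exp_pos _).le
              linarith
          _ ≤ exp 8 * (M / s ^ n * (B / s ^ 2) + 2 * (n * (B / s * (M / s ^ n / s)))) :=
              mul_le_mul_of_nonneg_right (hm_le x t ht) (by positivity)
          _ = C₁ / s ^ (n + 2) := by
              rw [hC₁, pow_add]
              field_simp
    set A := ∫ x in K, q (x, t₁) * (φ (x, t₁) * Γ (x, t₁)) with hA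
    have slice_bound : ∀ t ∈ Ioc (t₁ - s ^ 2) (t₁ - s ^ 2 / 2),
        A - C₁ / s ^ (n + 2) * I ≤ exp 8 * M / s ^ n * ∫ x in K, q (x, t) := by
      intro t ht
      have htI : t ∈ Icc (t₁ - s ^ 2) t₁ := ⟨ht.1.le, by linarith [ht.2]⟩
      have hsubI : Icc t t₁ ⊆ Icc (t₁ - s ^ 2) t₁ := Icc_subset_Icc_left htI.1
      have h := subsolution_integral_le (U := U') (K := K) (q := q)
        (Ψ := fun y => m y * (φ y * Γ y)) hU'o hKc htI.2
        (fun x r hr => hmem x r (hsubI hr)) (hq.mono inter_subset_left)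
        (hms.contDiffOn.mul (hφs.contDiffOn.mul hΓs)) (fun z _ hzK => by simp [hφzero z hzK])
        (fun z hz => hq0 z hz.1)
        (fun z _ => mul_nonneg (exp_pos _).le (mul_nonneg (hφ0 z) (backGauss_pos _ _ _).le))
        (fun _ => 8 / s ^ 2) (C₁ / s ^ (n + 2)) (fun x hx r hr => hsub x hx r (hsubI hr))
        (fun x hx r hr => hsup x hx r (hsubI hr))
      have e1 : ∫ x in K, q (x, t₁) * (m (x, t₁) * (φ (x, t₁) * Γ (x, t₁))) = A := by
        simp [hA, hm]
      have e2 : ∫ x in K, q (x, t) * (m (x, t) * (φ (x, t) * Γ (x, t)))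
          ≤ exp 8 * M / s ^ n * ∫ x in K, q (x, t) := by
        rw [← integral_const_mul]
        have hc1 : Continuous fun x => q (x, t) * (m (x, t) * (φ (x, t) * Γ (x, t))) :=
          SmoothOn.continuous_slice (f := fun z => q z * (m z * (φ z * Γ z))) hU'o
            (fun x => hmem x t htI)
            ((hq.mono inter_subset_left).mul (hms.contDiffOn.mul (hφs.contDiffOn.mul hΓs)))
        refine setIntegral_mono_on (hc1.continuousOn.integrableOn_compact hKc)
          ((hslice t htI).const_mul _) hKc.measurableSet fun x hx => ?_
        rw [mul_comm (exp 8 * M / s ^ n)]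
        refine mul_le_mul_of_nonneg_left ?_ (hq0 _ (hUs x t htI))
        have hΓle : Γ (x, t) ≤ M / s ^ n := by
          refine backGauss_le_of_time hs ?_
          change s ^ 2 / 2 ≤ τ - t
          linarith [ht.2]
        calc m (x, t) * (φ (x, t) * Γ (x, t)) ≤ exp 8 * (1 * (M / s ^ n)) := by
              refine mul_le_mul (hm_le x t htI) ?_
                (mul_nonneg (hφ0 _) (backGauss_pos _ _ _).le) (exp_pos _).le
              exact mul_le_mul (hφ1 _) hΓle (backGauss_pos _ _ _).le zero_le_one
          _ = exp 8 * M / s ^ n := by ring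
      have e3 : ∫ z in K ×ˢ Ioc t t₁, q z ≤ I :=
        setIntegral_mono_set hqI hqnn
          (LE.le.eventuallyLE (Set.prod_mono le_rfl (Ioc_subset_Ioc_left htI.1)))
      have e4 : C₁ / s ^ (n + 2) * ∫ z in K ×ˢ Ioc t t₁, q z ≤ C₁ / s ^ (n + 2) * I :=
        mul_le_mul_of_nonneg_left e3 (by positivity)
      rw [e1] at h
      linarith
    -- average over the initial time
    have hqI' : Integrable q ((volume.restrict K).prod
        (volume.restrict (Ioc (t₁ - s ^ 2) (t₁ - s ^ 2 / 2)))) := by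
      rw [Measure.prod_restrict]
      exact hqI.mono_set (Set.prod_mono le_rfl (Ioc_subset_Ioc_right (by linarith)))
    have avg : s ^ 2 / 2 * (A - C₁ / s ^ (n + 2) * I) ≤ exp 8 * M / s ^ n * I := by
      have h1 : ∫ _t in Ioc (t₁ - s ^ 2) (t₁ - s ^ 2 / 2), (A - C₁ / s ^ (n + 2) * I)
          ≤ ∫ t in Ioc (t₁ - s ^ 2) (t₁ - s ^ 2 / 2), exp 8 * M / s ^ n * ∫ x in K, q (x, t) :=
        setIntegral_mono_on (integrableOn_const (by simp))
          (hqI'.integral_prod_right.const_mul _) measurableSet_Ioc slice_bound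
      rw [integral_const_mul, setIntegral_const, smul_eq_mul, Real.volume_real_Ioc_of_le
        (by linarith)] at h1
      have h2 : ∫ t in Ioc (t₁ - s ^ 2) (t₁ - s ^ 2 / 2), ∫ x in K, q (x, t) ≤ I := by
        rw [← integral_integral_swap (f := fun x t => q (x, t)) hqI',
          ← integral_prod (f := q) hqI', Measure.prod_restrict, ← Measure.volume_eq_prod]
        exact setIntegral_mono_set hqI hqnn
          (LE.le.eventuallyLE
            (Set.prod_mono le_rfl (Ioc_subset_Ioc_right (by linarith))))
      have h3 := mul_le_mul_of_nonneg_left h2 (by positivity : 0 ≤ exp 8 * M / s ^ n)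
      have h4 : t₁ - s ^ 2 / 2 - (t₁ - s ^ 2) = s ^ 2 / 2 := by ring
      rw [h4] at h1
      exact h1.trans h3
    have e5 : (2 * exp 8 * M + C₁) / s ^ (n + 2) * I
        = 2 / s ^ 2 * (exp 8 * M / s ^ n * I) + C₁ / s ^ (n + 2) * I := by
      rw [pow_add]
      field_simp
    rw [e5]
    have e6 := mul_le_mul_of_nonneg_left avg (by positivity : 0 ≤ 2 / s ^ 2)
    have e7 : 2 / s ^ 2 * (s ^ 2 / 2 * (A - C₁ / s ^ (n + 2) * I))
        = A - C₁ / s ^ (n + 2) * I := by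
      field_simp
    linarith
  -- concentrate the weight at the centre
  have ht₁ : t₁ ∈ Icc (t₁ - s ^ 2) t₁ := ⟨by linarith, le_rfl⟩
  have hgs : Continuous fun x => q (x, t₁) * φ (x, t₁) :=
    (hq.continuous_slice hU fun x => hUs x t₁ ht₁).mul
      (hφs.continuous.comp (by fun_prop : Continuous fun x : Sp n => (x, t₁)))
  have hgi : Integrable fun x => q (x, t₁) * φ (x, t₁) :=
    hgs.integrable_of_hasCompactSupport
      (HasCompactSupport.intro hKc fun x hx => by simp [hφzero (x, t₁) hx])
  have hlim := (tendsto_gaussian_average hgi (x₁ := x₁) hgs.continuousAt).const_mul (2 ^ n)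
  have hle : 2 ^ n * (π ^ ((n : ℝ) / 2) * (q (x₁, t₁) * φ (x₁, t₁)))
      ≤ (2 * exp 8 * M + C₁) / s ^ (n + 2) * I := by
    refine le_of_tendsto hlim ?_
    filter_upwards [Filter.eventually_ge_atTop s⁻¹] with c hc
    have hc0 : 0 < c := lt_of_lt_of_le (by positivity) hc
    have hcs : (4 * c ^ 2)⁻¹ ≤ s ^ 2 := by
      have h1 : 1 ≤ c * s := by
        rw [inv_le_iff_one_le_mul₀ hs] at hc
        exact hc
      rw [inv_le_iff_one_le_mul₀ (by positivity)]
      nlinarith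
    refine le_trans (le_of_eq ?_) (main c hc0 hcs)
    rw [← integral_const_mul,
      setIntegral_eq_integral_of_forall_compl_eq_zero fun x hx => by simp [hφzero (x, t₁) hx]]
    refine integral_congr_ae (.of_forall fun x => ?_)
    simp only
    rw [backGauss_terminal x x₁ t₁ hc0]
    ring
  rw [hφone (x₁, t₁) (by simpa using by positivity), mul_one] at hle
  refine le_trans ?_ hle
  have hq1 : 0 ≤ q (x₁, t₁) := hq0 _ (hUs x₁ t₁ ht₁)
  have hp1 : 1 ≤ π ^ ((n : ℝ) / 2) :=
    Real.one_le_rpow (by linarith [Real.pi_gt_three]) (by positivity)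
  have hp2 : (1 : ℝ) ≤ 2 ^ n := one_le_pow₀ (by norm_num)
  calc q (x₁, t₁) = 1 * (1 * q (x₁, t₁)) := by ring
    _ ≤ 2 ^ n * (π ^ ((n : ℝ) / 2) * q (x₁, t₁)) := by gcongr

end MeanValueInequality

/-- If the mean value inequality forces scale-invariant smallness, a point-picking argument bounds
a solution of `(∂ₜ - Δ) e ≤ 2 e²` at the top centre of a parabolic cylinder. -/
lemma sq_mul_le_of_small_morrey {n : ℕ} {C p δ r : ℝ} {U : Set (Sp n × ℝ)} {e : Sp n × ℝ → ℝ}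
    (hC0 : 0 < C)
    (hC : ∀ (x₁ : Sp n) (t₁ s : ℝ), 0 < s →
      (∀ x, ∀ t ∈ Icc (t₁ - s ^ 2) t₁, (x, t) ∈ U) →
      (∀ x ∈ closedBall x₁ s, ∀ t ∈ Icc (t₁ - s ^ 2) t₁,
        heatOp e (x, t) ≤ 8 / s ^ 2 * e (x, t)) →
      e (x₁, t₁) ≤ C / s ^ (n + 2) * ∫ z in pcyl (x₁, t₁) s, e z)
    (hp1 : 1 < p) (hp2 : p ≤ 2) (hδ : 4 * C * δ < (1 / 64 : ℝ) ^ (p / 2))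
    (he : ContinuousOn e U) (he0 : ∀ z, 0 ≤ e z)
    (hle : ∀ z ∈ U, heatOp e z ≤ 2 * e z ^ 2) (x₀ : Sp n) (t₀ : ℝ) (hr : 0 < r)
    (hU : ∀ x, ∀ t ∈ Icc (t₀ - r ^ 2) t₀, (x, t) ∈ U)
    (hM : ∀ x, ∀ t ∈ Icc (t₀ - r ^ 2) t₀, ∀ s, 0 < s → s ≤ r / 2 → t₀ - r ^ 2 ≤ t - s ^ 2 →
      s ^ (p - n - 2) * ∫ w in pcyl (x, t) s, e w ^ (p / 2) ≤ δ) :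
    r ^ 2 * e (x₀, t₀) ≤ 1 / 16 := by
  set Q : Set (Sp n × ℝ) := closedBall x₀ r ×ˢ Icc (t₀ - r ^ 2) t₀ with hQ
  have hQc : IsCompact Q := (isCompact_closedBall x₀ r).prod isCompact_Icc
  have hQU : Q ⊆ U := fun z hz => hU z.1 z.2 hz.2
  set d : Sp n × ℝ → ℝ := fun z => min (r - dist z.1 x₀) (√(z.2 - t₀ + r ^ 2)) with hd
  have hdc : Continuous d := by fun_prop
  have hr2 : 0 < r ^ 2 := by positivity
  have hz₀ : (x₀, t₀) ∈ Q := ⟨mem_closedBall_self hr.le, by simp [hr2.le]⟩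
  obtain ⟨z₁, hz₁, hmax⟩ := hQc.exists_isMaxOn ⟨_, hz₀⟩
    (f := fun z => d z ^ 2 * e z) ((hdc.pow 2).continuousOn.mul (he.mono hQU))
  have hmax' : ∀ z ∈ Q, d z ^ 2 * e z ≤ d z₁ ^ 2 * e z₁ := fun z hz => hmax hz
  have hd₀ : d (x₀, t₀) = r := by simp [hd, Real.sqrt_sq hr.le]
  have h₀ := hmax' _ hz₀
  rw [hd₀] at h₀
  refine h₀.trans ?_
  obtain ⟨x₁, t₁⟩ := z₁
  have hdn : 0 ≤ d (x₁, t₁) := le_min (sub_nonneg.2 hz₁.1) (Real.sqrt_nonneg _)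
  set e₁ := e (x₁, t₁) with he₁
  rcases (he0 (x₁, t₁)).eq_or_lt with h | (he₁pos : 0 < e₁)
  · rw [he₁, ← h]; norm_num
  rcases hdn.eq_or_lt with h | hdpos
  · rw [← h]; norm_num
  set ρ := d (x₁, t₁) / 2 with hρ
  have hρ0 : 0 < ρ := by positivity
  have hd₁ : d (x₁, t₁) = 2 * ρ := by rw [hρ]; ring
  have hdx : 2 * ρ ≤ r - dist x₁ x₀ := hd₁ ▸ min_le_left _ _
  have hdt : 4 * ρ ^ 2 ≤ t₁ - t₀ + r ^ 2 := by
    have h1 : 2 * ρ ≤ √(t₁ - t₀ + r ^ 2) := hd₁ ▸ min_le_right _ _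
    have h2 := (Real.le_sqrt' (by positivity)).1 h1
    linarith [mul_pow 2 ρ 2]
  have hρr : ρ ≤ r / 2 := by linarith [dist_nonneg (x := x₁) (y := x₀)]
  set s := min ρ (1 / √e₁) with hs
  have hsq : 0 < √e₁ := Real.sqrt_pos.2 he₁pos
  have hs0 : 0 < s := lt_min hρ0 (by positivity)
  have hsρ : s ≤ ρ := min_le_left _ _
  have hs2 : s ^ 2 ≤ ρ ^ 2 := by gcongr
  have hse : s ^ 2 * e₁ ≤ 1 := by
    have : s * √e₁ ≤ 1 := (le_div_iff₀ hsq).1 (min_le_right _ _)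
    calc s ^ 2 * e₁ = (s * √e₁) ^ 2 := by rw [mul_pow, Real.sq_sqrt he₁pos.le]
      _ ≤ 1 := pow_le_one₀ (by positivity) this
  have ht₁ : t₁ ≤ t₀ := hz₁.2.2
  have hslab : ∀ x, ∀ t ∈ Icc (t₁ - s ^ 2) t₁, (x, t) ∈ U := fun x t ht =>
    hU x t ⟨by nlinarith [ht.1], ht.2.trans ht₁⟩
  have hbound : ∀ x ∈ closedBall x₁ s, ∀ t ∈ Icc (t₁ - s ^ 2) t₁, e (x, t) ≤ 4 * e₁ := by
    intro x hx t ht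
    have hx' : dist x x₀ ≤ dist x₁ x₀ + ρ := by
      have h1 := dist_triangle x x₁ x₀
      have h2 : dist x x₁ ≤ s := hx
      linarith
    have hmem : (x, t) ∈ Q :=
      ⟨mem_closedBall.2 (by linarith), by nlinarith [ht.1], ht.2.trans ht₁⟩
    have hdρ : ρ ≤ d (x, t) :=
      le_min (by linarith) ((Real.le_sqrt' hρ0).2 (by nlinarith [ht.1]))
    have h1 := hmax' _ hmem
    rw [hd₁] at h1
    have h2 : ρ ^ 2 * e (x, t) ≤ d (x, t) ^ 2 * e (x, t) := by
      gcongr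
      exact he0 _
    have h3 : ρ ^ 2 * e (x, t) ≤ ρ ^ 2 * (4 * e₁) := by linarith [mul_pow 2 ρ 2]
    exact le_of_mul_le_mul_left h3 (by positivity)
  have hmv := hC x₁ t₁ s hs0 hslab fun x hx t ht => by
    have h1 := hle _ (hslab x t ht)
    have h2 := hbound x hx t ht
    have h3 : e₁ ≤ 1 / s ^ 2 := (le_div_iff₀ (by positivity)).2 (by linarith)
    have h4 := he0 (x, t)
    calc heatOp e (x, t) ≤ 2 * e (x, t) * e (x, t) := by linarith
      _ ≤ 2 * (4 * (1 / s ^ 2)) * e (x, t) := by gcongr; linarith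
      _ = 8 / s ^ 2 * e (x, t) := by ring
  have hM₁ := hM x₁ t₁ hz₁.2 s hs0 (hsρ.trans hρr) (by nlinarith)
  set K : Set (Sp n × ℝ) := closedBall x₁ s ×ˢ Icc (t₁ - s ^ 2) t₁
  have hKc : IsCompact K := (isCompact_closedBall x₁ s).prod isCompact_Icc
  have hKe : ContinuousOn e K := he.mono fun z hz => hslab z.1 z.2 hz.2
  have hcyl : pcyl (x₁, t₁) s ⊆ K := prod_mono_right Ioc_subset_Icc_self
  have hi1 : IntegrableOn e (pcyl (x₁, t₁) s) := (hKe.integrableOn_compact hKc).mono_set hcyl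
  have hi2 : IntegrableOn (fun z => e z ^ (p / 2)) (pcyl (x₁, t₁) s) :=
    ((hKe.rpow_const fun _ _ => Or.inr (by linarith)).integrableOn_compact hKc).mono_set hcyl
  have hmeas : MeasurableSet (pcyl (x₁, t₁) s) := measurableSet_closedBall.prod measurableSet_Ioc
  have hI : ∫ z in pcyl (x₁, t₁) s, e z
      ≤ 4 * e₁ ^ (1 - p / 2) * ∫ z in pcyl (x₁, t₁) s, e z ^ (p / 2) := by
    rw [← integral_const_mul]
    refine setIntegral_mono_on hi1 (hi2.const_mul _) hmeas fun z hz => ?_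
    have hb := hbound z.1 (hcyl hz).1 z.2 (hcyl hz).2
    have hz0 := he0 z
    calc e z = e z ^ (1 - p / 2) * e z ^ (p / 2) := by
          rw [← Real.rpow_add_of_nonneg hz0 (by linarith) (by linarith)]; simp
      _ ≤ (4 * e₁) ^ (1 - p / 2) * e z ^ (p / 2) := by
          gcongr
          linarith
      _ = 4 ^ (1 - p / 2) * e₁ ^ (1 - p / 2) * e z ^ (p / 2) := by
          rw [Real.mul_rpow (by norm_num) he₁pos.le]
      _ ≤ 4 * e₁ ^ (1 - p / 2) * e z ^ (p / 2) := by
          gcongr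
          exact Real.rpow_le_self_of_one_le (by norm_num) (by linarith)
  set I := ∫ z in pcyl (x₁, t₁) s, e z ^ (p / 2) with hIdef
  have hI0 : 0 ≤ I := setIntegral_nonneg hmeas fun z _ => Real.rpow_nonneg (he0 z) _
  have hy : (s ^ 2 * e₁) ^ (p / 2) ≤ 4 * C * δ := by
    have hsp : s ^ (p - n - 2) = s ^ p / s ^ (n + 2) := by
      rw [show p - n - 2 = p - ((n + 2 : ℕ) : ℝ) by push_cast; ring, Real.rpow_sub hs0,
        Real.rpow_natCast]
    have hep : e₁ ^ (p / 2) = e₁ / e₁ ^ (1 - p / 2) := by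
      rw [eq_div_iff (by positivity), ← Real.rpow_add he₁pos]; simp
    have h1 : (s ^ 2 * e₁) ^ (p / 2) = s ^ p * (e₁ / e₁ ^ (1 - p / 2)) := by
      rw [Real.mul_rpow (by positivity) he₁pos.le, hep, ← Real.rpow_natCast, ← Real.rpow_mul hs0.le]
      congr 2
      push_cast
      ring
    have h2 : e₁ ≤ C / s ^ (n + 2) * (4 * e₁ ^ (1 - p / 2) * I) :=
      hmv.trans (by gcongr)
    have h3 : e₁ / e₁ ^ (1 - p / 2) ≤ C / s ^ (n + 2) * (4 * I) := by
      rw [div_le_iff₀ (by positivity)]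
      linarith
    calc (s ^ 2 * e₁) ^ (p / 2) ≤ s ^ p * (C / s ^ (n + 2) * (4 * I)) := by
          rw [h1]; gcongr
      _ = 4 * C * (s ^ (p - n - 2) * I) := by rw [hsp]; ring
      _ ≤ 4 * C * δ := by gcongr
  have hlt : s ^ 2 * e₁ < 1 / 64 :=
    (Real.rpow_lt_rpow_iff (by positivity) (by norm_num) (by linarith)).1 (hy.trans_lt hδ)
  have hsρ' : s = ρ := by
    rcases min_choice ρ (1 / √e₁) with h | h
    · exact h
    · exfalso
      have : s ^ 2 * e₁ = 1 := by
        rw [hs, h, div_pow, Real.sq_sqrt he₁pos.le]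
        field_simp
      linarith
  rw [hd₁]
  rw [hsρ'] at hlt
  linarith [mul_pow 2 ρ 2]

section Strip

variable {n k : ℕ}

lemma isOpen_strip (T : EReal) : IsOpen {z : Sp n × ℝ | 0 < z.2 ∧ (z.2 : EReal) < T} :=
  (isOpen_lt continuous_const continuous_snd).inter
    (isOpen_lt (continuous_coe_real_ereal.comp continuous_snd) continuous_const)

lemma MorreySmall.gradSq_energy_le {u : Sp n × ℝ → Fin k → ℝ} {T : EReal} {p R₀ ε : ℝ}
    (h : MorreySmall u T p R₀ ε) (hp : 1 < p) (x : Sp n) {t r : ℝ} (ht : 0 < t)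
    (htT : (t : EReal) < T) (hr : 0 < r) (hrR : r < min R₀ (√t)) :
    r ^ (p - n - 2) * ∫ w in pcyl (x, t) r, gradSq u w ^ (p / 2) ≤ ε ^ p := by
  obtain ⟨A, B, hAB, hA, hB⟩ := h
  have hmeas : MeasurableSet (pcyl (x, t) r) := measurableSet_closedBall.prod measurableSet_Ioc
  have hB0 : 0 ≤ B := (hB x t r ht htT hr hrR).trans' <| Real.rpow_nonneg (mul_nonneg
    (Real.rpow_nonneg hr.le _)
    (setIntegral_nonneg hmeas fun z _ => Real.rpow_nonneg (dtSq_nonneg u z) _)) _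
  have hI0 : 0 ≤ r ^ (p - n - 2) * ∫ w in pcyl (x, t) r, gradSq u w ^ (p / 2) := mul_nonneg
    (Real.rpow_nonneg hr.le _)
    (setIntegral_nonneg hmeas fun z _ => Real.rpow_nonneg (gradSq_nonneg u z) _)
  have hAε := (hA x t r ht htT hr hrR).trans (show A ≤ ε by linarith)
  have := Real.rpow_le_rpow (Real.rpow_nonneg hI0 _) hAε (show 0 ≤ p by linarith)
  rwa [← Real.rpow_mul hI0, one_div_mul_cancel (by linarith), Real.rpow_one] at this

/-- `ε`-regularity: small Morrey norm on unit scale bounds the energy density. -/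
lemma HeatFlow.gradSq_le_of_morreySmall {C p ε : ℝ} (hC0 : 0 < C)
    (hC : ∀ U : Set (Sp n × ℝ), IsOpen U → ∀ q : Sp n × ℝ → ℝ, SmoothOn q U →
      (∀ z ∈ U, 0 ≤ q z) → ∀ (x₁ : Sp n) (t₁ s : ℝ), 0 < s →
      (∀ x, ∀ t ∈ Icc (t₁ - s ^ 2) t₁, (x, t) ∈ U) →
      (∀ x ∈ closedBall x₁ s, ∀ t ∈ Icc (t₁ - s ^ 2) t₁,
        heatOp q (x, t) ≤ 8 / s ^ 2 * q (x, t)) →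
      q (x₁, t₁) ≤ C / s ^ (n + 2) * ∫ z in pcyl (x₁, t₁) s, q z)
    (hp1 : 1 < p) (hp2 : p ≤ 2) (hε : 4 * C * ε ^ p < (1 / 64 : ℝ) ^ (p / 2))
    {u : Sp n × ℝ → Fin k → ℝ} {T : EReal}
    (hu : ContDiffOn ℝ (⊤ : ℕ∞) u {z : Sp n × ℝ | 0 < z.2 ∧ (z.2 : EReal) < T})
    (hflow : HeatFlow u {z : Sp n × ℝ | 0 < z.2 ∧ (z.2 : EReal) < T})
    (hsph : SphereValued u {z : Sp n × ℝ | 0 < z.2 ∧ (z.2 : EReal) < T})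
    (hM : MorreySmall u T p 1 ε) (x₀ : Sp n) {t₀ : ℝ} (ht₀ : 0 < t₀) (htT : (t₀ : EReal) < T) :
    gradSq u (x₀, t₀) ≤ 1 / 4 * (1 + 1 / t₀) := by
  have hU := isOpen_strip (n := n) T
  set U := {z : Sp n × ℝ | 0 < z.2 ∧ (z.2 : EReal) < T}
  set m := min 1 (√t₀) with hm
  have hm0 : 0 < m := lt_min one_pos (Real.sqrt_pos.2 ht₀)
  have hm1 : m ≤ 1 := min_le_left _ _
  have hmt : m ^ 2 ≤ t₀ := by
    calc m ^ 2 ≤ √t₀ ^ 2 := by gcongr; exact min_le_right _ _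
      _ = t₀ := Real.sq_sqrt ht₀.le
  have hpos : ∀ t ∈ Icc (t₀ - (m / 2) ^ 2) t₀, 0 < t ∧ (t : EReal) < T := fun t ht =>
    ⟨by nlinarith [ht.1], (EReal.coe_le_coe_iff.2 ht.2).trans_lt htT⟩
  have key : (m / 2) ^ 2 * gradSq u (x₀, t₀) ≤ 1 / 16 := by
    refine sq_mul_le_of_small_morrey (U := U) hC0
      (hC U hU _ (smoothOn_gradSq hU hu) fun z _ => gradSq_nonneg u z)
      hp1 hp2 hε (smoothOn_gradSq hU hu).continuousOn (gradSq_nonneg u)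
      (fun z hz => hflow.heatOp_gradSq_le hU hu hsph hz) x₀ t₀ (by positivity)
      (fun x t ht => hpos t ht) fun x t ht s hs hsm hst => ?_
    refine hM.gradSq_energy_le hp1 x (hpos t ht).1 (hpos t ht).2 hs (lt_min (by linarith) ?_)
    exact Real.lt_sqrt_of_sq_lt (by nlinarith)
  have hg := gradSq_nonneg u (x₀, t₀)
  have h4 : m ^ 2 * gradSq u (x₀, t₀) ≤ 1 / 4 := by linarith [div_pow m 2 2]
  rcases min_choice 1 (√t₀) with h | h
  · rw [hm, h] at h4
    have : 0 < 1 / t₀ := by positivity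
    linarith
  · rw [hm, h, Real.sq_sqrt ht₀.le, mul_comm, ← le_div_iff₀ ht₀] at h4
    refine h4.trans ?_
    rw [div_div, ← one_div_mul_one_div]
    linarith

end Strip

section Uniqueness

variable {n k : ℕ} {u u₁ u₂ : Sp n × ℝ → Fin k → ℝ} {T : EReal}

lemma sq_le_mul_integral_deriv_sq {f f' : ℝ → ℝ} {t : ℝ} (ht : 0 < t)
    (hf : ContinuousOn f (Icc 0 t)) (hf0 : f 0 = 0) (hd : ∀ s ∈ Ioc 0 t, HasDerivAt f (f' s) s)
    (hc : ContinuousOn f' (Ioc 0 t)) (hi : IntegrableOn (fun s => f' s ^ 2) (Ioc 0 t)) :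
    f t ^ 2 ≤ t * ∫ s in Ioc 0 t, f' s ^ 2 := by
  have h1 : IntegrableOn (fun _ : ℝ => (1 : ℝ)) (Ioc 0 t) := integrableOn_const (by simp)
  have hf'i : IntegrableOn f' (Ioc 0 t) := by
    refine Integrable.mono' (h1.add hi) (hc.aestronglyMeasurable measurableSet_Ioc)
      (Filter.Eventually.of_forall fun s => ?_)
    simp only [Pi.add_apply, Real.norm_eq_abs]
    nlinarith [sq_nonneg (|f' s| - 1), sq_abs (f' s), abs_nonneg (f' s)]
  have hftc : ∫ s in Ioc 0 t, f' s = f t := by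
    rw [← intervalIntegral.integral_of_le ht.le,
      intervalIntegral.integral_eq_sub_of_hasDerivAt_of_le ht.le hf
        (fun s hs => hd s (Ioo_subset_Ioc_self hs))
        ((intervalIntegrable_iff_integrableOn_Ioc_of_le ht.le).2 hf'i), hf0, sub_zero]
  have hsq : 0 ≤ ∫ s in Ioc 0 t, (t * f' s - f t) ^ 2 :=
    setIntegral_nonneg measurableSet_Ioc fun s _ => sq_nonneg _
  have hexp : ∫ s in Ioc 0 t, (t * f' s - f t) ^ 2
      = t ^ 2 * (∫ s in Ioc 0 t, f' s ^ 2) - 2 * t * f t * f t + t * f t ^ 2 := by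
    have : ∀ s, (t * f' s - f t) ^ 2 = t ^ 2 * f' s ^ 2 - 2 * t * f t * f' s + f t ^ 2 * 1 := by
      intro s; ring
    simp only [this]
    have h2 : IntegrableOn (fun s => t ^ 2 * f' s ^ 2 - 2 * t * f t * f' s) (Ioc 0 t) :=
      (hi.const_mul _).sub (hf'i.const_mul _)
    rw [integral_add h2 (h1.const_mul _), integral_sub (hi.const_mul _) (hf'i.const_mul _), integral_const_mul, integral_const_mul,
      integral_const_mul, hftc]
    simp [ht.le]
    ring
  rw [hexp] at hsq
  have : 0 ≤ t * (t * (∫ s in Ioc 0 t, f' s ^ 2) - f t ^ 2) := by linarith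
  linarith [nonneg_of_mul_nonneg_right this ht]

lemma dist_sq_le_integral_dtSq
    (hc₁ : ContinuousOn u₁ {z : Sp n × ℝ | 0 ≤ z.2 ∧ (z.2 : EReal) < T})
    (hc₂ : ContinuousOn u₂ {z : Sp n × ℝ | 0 ≤ z.2 ∧ (z.2 : EReal) < T})
    (hu₁ : ContDiffOn ℝ (⊤ : ℕ∞) u₁ {z : Sp n × ℝ | 0 < z.2 ∧ (z.2 : EReal) < T})
    (hu₂ : ContDiffOn ℝ (⊤ : ℕ∞) u₂ {z : Sp n × ℝ | 0 < z.2 ∧ (z.2 : EReal) < T})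
    {x : Sp n} (h0 : u₁ (x, 0) = u₂ (x, 0)) {t : ℝ} (ht : 0 < t) (htT : (t : EReal) < T)
    (hi : IntegrableOn (fun s => 2 * (dtSq u₁ (x, s) + dtSq u₂ (x, s))) (Ioc 0 t)) :
    ∑ i, (u₁ (x, t) i - u₂ (x, t) i) ^ 2
      ≤ t * ∫ s in Ioc 0 t, 2 * (dtSq u₁ (x, s) + dtSq u₂ (x, s)) := by
  have hU := isOpen_strip (n := n) T
  set U := {z : Sp n × ℝ | 0 < z.2 ∧ (z.2 : EReal) < T}
  have hle : ∀ s, s ≤ t → (s : EReal) < T := fun s hs =>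
    (EReal.coe_le_coe_iff.2 hs).trans_lt htT
  have hmem : ∀ s ∈ Ioc 0 t, (x, s) ∈ U := fun s hs => ⟨hs.1, hle s hs.2⟩
  have hw : ∀ i, SmoothOn (fun z => u₁ z i - u₂ z i) U := fun i =>
    (smoothOn_component hu₁ i).sub (smoothOn_component hu₂ i)
  set D : Fin k → ℝ → ℝ := fun i s => dirDeriv (tdir n) (fun z => u₁ z i - u₂ z i) (x, s)
  have hD : ∀ i, ContinuousOn (D i) (Ioc 0 t) := fun i =>
    ((hw i).dirDeriv hU (tdir n)).continuousOn.comp (f := fun s : ℝ => (x, s)) (by fun_prop) hmem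
  have hsum : ∀ s ∈ Ioc 0 t, ∑ i, D i s ^ 2 ≤ 2 * (dtSq u₁ (x, s) + dtSq u₂ (x, s)) := by
    intro s hs
    rw [dtSq, dtSq, ← Finset.sum_add_distrib, Finset.mul_sum]
    refine Finset.sum_le_sum fun i _ => ?_
    have : D i s = pd u₁ i (tdir n) (x, s) - pd u₂ i (tdir n) (x, s) :=
      dirDeriv_sub ((smoothOn_component hu₁ i).differentiableAt hU (hmem s hs))
        ((smoothOn_component hu₂ i).differentiableAt hU (hmem s hs)) (tdir n)
    rw [this]
    nlinarith [sq_nonneg (pd u₁ i (tdir n) (x, s) + pd u₂ i (tdir n) (x, s))]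
  have hDi : ∀ i, IntegrableOn (fun s => D i s ^ 2) (Ioc 0 t) := fun i =>
    Integrable.mono' hi (((hD i).pow 2).aestronglyMeasurable measurableSet_Ioc)
      ((ae_restrict_iff' measurableSet_Ioc).2 (Filter.Eventually.of_forall fun s hs => by
        rw [Real.norm_of_nonneg (sq_nonneg _)]
        exact (Finset.single_le_sum (f := fun i => D i s ^ 2) (fun j _ => sq_nonneg _)
          (Finset.mem_univ i)).trans (hsum s hs)))
  have hslice : ∀ {v : Sp n × ℝ → Fin k → ℝ},
      ContinuousOn v {z : Sp n × ℝ | 0 ≤ z.2 ∧ (z.2 : EReal) < T} → ∀ i,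
      ContinuousOn (fun s => v (x, s) i) (Icc 0 t) := fun hv i =>
    (continuousOn_pi.1 hv i).comp (f := fun s : ℝ => (x, s)) (by fun_prop)
      fun s hs => ⟨hs.1, hle s hs.2⟩
  calc ∑ i, (u₁ (x, t) i - u₂ (x, t) i) ^ 2 ≤ ∑ i, t * ∫ s in Ioc 0 t, D i s ^ 2 :=
        Finset.sum_le_sum fun i _ => sq_le_mul_integral_deriv_sq
          (f := fun s => u₁ (x, s) i - u₂ (x, s) i) ht ((hslice hc₁ i).sub (hslice hc₂ i))
          (by simp [h0])
          (fun s hs => hasDerivAt_slice ((hw i).differentiableAt hU (hmem s hs))) (hD i) (hDi i)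
    _ = t * ∫ s in Ioc 0 t, ∑ i, D i s ^ 2 := by
        rw [integral_finsetSum _ fun i _ => hDi i, Finset.mul_sum]
    _ ≤ _ := by
        refine mul_le_mul_of_nonneg_left ?_ ht.le
        exact setIntegral_mono_on (integrable_finsetSum _ fun i _ => hDi i) hi
          measurableSet_Ioc hsum

lemma integrableOn_dtSq
    (hu : ContDiffOn ℝ (⊤ : ℕ∞) u {z : Sp n × ℝ | 0 < z.2 ∧ (z.2 : EReal) < T})
    (hi : IntegrableOn (fun z => gradSq u z + dtSq u z)
      {z : Sp n × ℝ | 0 < z.2 ∧ (z.2 : EReal) < T}) :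
    IntegrableOn (dtSq u) {z : Sp n × ℝ | 0 < z.2 ∧ (z.2 : EReal) < T} := by
  have hU := isOpen_strip (n := n) T
  refine Integrable.mono' hi
    ((smoothOn_dtSq hU hu).continuousOn.aestronglyMeasurable hU.measurableSet)
    (Filter.Eventually.of_forall fun z => ?_)
  rw [Real.norm_of_nonneg (dtSq_nonneg u z)]
  linarith [gradSq_nonneg u z]

/-- Finite energy and equal initial values force the `L²` distance to vanish linearly in time. -/
lemma exists_integral_dist_sq_le
    (hc₁ : ContinuousOn u₁ {z : Sp n × ℝ | 0 ≤ z.2 ∧ (z.2 : EReal) < T})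
    (hc₂ : ContinuousOn u₂ {z : Sp n × ℝ | 0 ≤ z.2 ∧ (z.2 : EReal) < T})
    (hu₁ : ContDiffOn ℝ (⊤ : ℕ∞) u₁ {z : Sp n × ℝ | 0 < z.2 ∧ (z.2 : EReal) < T})
    (hu₂ : ContDiffOn ℝ (⊤ : ℕ∞) u₂ {z : Sp n × ℝ | 0 < z.2 ∧ (z.2 : EReal) < T})
    (hi₁ : IntegrableOn (fun z => gradSq u₁ z + dtSq u₁ z)
      {z : Sp n × ℝ | 0 < z.2 ∧ (z.2 : EReal) < T})
    (hi₂ : IntegrableOn (fun z => gradSq u₂ z + dtSq u₂ z)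
      {z : Sp n × ℝ | 0 < z.2 ∧ (z.2 : EReal) < T})
    (h0 : ∀ x, u₁ (x, 0) = u₂ (x, 0)) :
    ∃ G : ℝ, 0 ≤ G ∧ ∀ K : Set (Sp n), IsCompact K → ∀ t : ℝ, 0 < t → (t : EReal) < T →
      ∫ x in K, ∑ i, (u₁ (x, t) i - u₂ (x, t) i) ^ 2 ≤ t * G := by
  have hU := isOpen_strip (n := n) T
  set U := {z : Sp n × ℝ | 0 < z.2 ∧ (z.2 : EReal) < T}
  set E : Sp n × ℝ → ℝ := fun z => 2 * (dtSq u₁ z + dtSq u₂ z)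
  have hE0 : ∀ z, 0 ≤ E z := fun z =>
    mul_nonneg two_pos.le (add_nonneg (dtSq_nonneg u₁ z) (dtSq_nonneg u₂ z))
  have hE : IntegrableOn E U :=
    ((integrableOn_dtSq hu₁ hi₁).add (integrableOn_dtSq hu₂ hi₂)).const_mul 2
  refine ⟨∫ z in U, E z, setIntegral_nonneg hU.measurableSet fun z _ => hE0 z,
    fun K hK t ht htT => ?_⟩
  have hsub : K ×ˢ Ioc 0 t ⊆ U := fun z hz =>
    ⟨hz.2.1, (EReal.coe_le_coe_iff.2 hz.2.2).trans_lt htT⟩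
  have hEK : Integrable E ((volume.restrict K).prod (volume.restrict (Ioc 0 t))) := by
    rw [Measure.prod_restrict, ← Measure.volume_eq_prod]
    exact hE.mono_set hsub
  have hcont : Continuous fun x => ∑ i, (u₁ (x, t) i - u₂ (x, t) i) ^ 2 :=
    SmoothOn.continuous_slice (f := fun z => ∑ i, (u₁ z i - u₂ z i) ^ 2) hU
      (fun x => ⟨ht, htT⟩) (ContDiffOn.sum fun i _ =>
        ((smoothOn_component hu₁ i).sub (smoothOn_component hu₂ i)).pow 2)
  calc ∫ x in K, ∑ i, (u₁ (x, t) i - u₂ (x, t) i) ^ 2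
      ≤ ∫ x in K, t * ∫ s in Ioc 0 t, E (x, s) := by
        refine integral_mono_ae (hcont.continuousOn.integrableOn_compact hK)
          (hEK.integral_prod_left.const_mul t) ?_
        filter_upwards [hEK.prod_right_ae] with x hx
        exact dist_sq_le_integral_dtSq hc₁ hc₂ hu₁ hu₂ (h0 x) ht htT hx
    _ = t * ∫ z in K ×ˢ Ioc 0 t, E z := by
        rw [integral_const_mul, ← integral_prod E hEK, Measure.prod_restrict,
          ← Measure.volume_eq_prod]
    _ ≤ t * ∫ z in U, E z := by
        refine mul_le_mul_of_nonneg_left ?_ ht.le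
        exact setIntegral_mono_set hE (Filter.Eventually.of_forall hE0)
          (LE.le.eventuallyLE hsub)

end Uniqueness

section Vanishing

variable {n : ℕ} {T : EReal}

/-- The integrating factor `t ^ (-1/2) * exp (-t / 2)`. -/
def timeWeight (t : ℝ) : ℝ := exp (-(Real.log t + t) / 2)

lemma hasDerivAt_timeWeight {t : ℝ} (ht : 0 < t) :
    HasDerivAt timeWeight (-(1 / 2 * (1 + 1 / t)) * timeWeight t) t := by
  have h := (((Real.hasDerivAt_log ht.ne').add (hasDerivAt_id t)).neg.div_const 2).exp
  refine h.congr_deriv ?_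
  simp only [timeWeight, Pi.add_apply, Pi.neg_apply, id]
  ring

lemma timeWeight_anti {s t : ℝ} (hs : 0 < s) (hst : s ≤ t) : timeWeight t ≤ timeWeight s := by
  have := Real.log_le_log hs hst
  exact exp_le_exp.2 (by linarith)

lemma timeWeight_mul_le_sqrt {t : ℝ} (ht : 0 < t) : timeWeight t * t ≤ √t := by
  calc timeWeight t * t = exp (-(Real.log t + t) / 2) * exp (Real.log t) := by
        rw [Real.exp_log ht, timeWeight]
    _ = exp ((Real.log t - t) / 2) := by rw [← Real.exp_add]; ring_nf
    _ ≤ exp (Real.log t / 2) := exp_le_exp.2 (by linarith)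
    _ = √t := by rw [Real.exp_half, Real.exp_log ht]

/-- A nonnegative subsolution of `∂ₜq ≤ Δq + ½ (1 + 1/t) q` whose spatial integrals vanish linearly
as `t → 0` is identically zero. -/
lemma eq_zero_of_heatOp_le {q : Sp n × ℝ → ℝ}
    (hq : SmoothOn q {z : Sp n × ℝ | 0 < z.2 ∧ (z.2 : EReal) < T})
    (hq0 : ∀ z, 0 ≤ q z)
    (hle : ∀ x : Sp n, ∀ t : ℝ, 0 < t → (t : EReal) < T →
      heatOp q (x, t) ≤ 1 / 2 * (1 + 1 / t) * q (x, t))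
    {G : ℝ} (hG0 : 0 ≤ G) (hG : ∀ K : Set (Sp n), IsCompact K → ∀ t : ℝ, 0 < t → (t : EReal) < T →
      ∫ x in K, q (x, t) ≤ t * G) (x : Sp n) {t₁ : ℝ} (ht₁ : 0 < t₁) (ht₁T : (t₁ : EReal) < T) :
    q (x, t₁) = 0 := by
  have hU := isOpen_strip (n := n) T
  set U := {z : Sp n × ℝ | 0 < z.2 ∧ (z.2 : EReal) < T}
  obtain ⟨C, hC0, hC⟩ := exists_cutoff n
  have hslice : ∀ t : ℝ, 0 < t → (t : EReal) < T → Continuous fun y => q (y, t) :=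
    fun t ht htT => hq.continuous_slice hU fun y => ⟨ht, htT⟩
  have hm : SmoothOn (fun z : Sp n × ℝ => timeWeight z.2) U :=
    Real.contDiff_exp.comp_contDiffOn
      (((contDiffOn_snd.log fun z hz => hz.1.ne').add contDiffOn_snd).neg.div_const 2)
  have key : ∀ t₀ : ℝ, 0 < t₀ → t₀ < min 1 t₁ →
      timeWeight t₁ * ∫ y in ball x (1 / 2), q (y, t₁) ≤ √t₀ * (G + C * (t₁ * (t₁ * G))) := by
    intro t₀ ht₀ hlt
    have ht₀1 : t₀ < 1 := hlt.trans_le (min_le_left _ _)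
    have ht₀₁ : t₀ ≤ t₁ := (hlt.trans_le (min_le_right _ _)).le
    have hR : 1 ≤ 1 / t₀ := by rw [le_div_iff₀ ht₀]; linarith
    obtain ⟨φ, hφs, hφ0, hφ1, hφone, hφzero, hφt, -, hφL⟩ := hC x (1 / t₀) (by positivity)
    set K := closedBall x (1 / t₀)
    have hK : IsCompact K := isCompact_closedBall _ _
    have hT : ∀ t, t ≤ t₁ → (t : EReal) < T := fun t ht =>
      (EReal.coe_le_coe_iff.2 ht).trans_lt ht₁T
    have hslab : ∀ y : Sp n, ∀ t ∈ Icc t₀ t₁, (y, t) ∈ U := fun y t ht =>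
      ⟨ht₀.trans_le ht.1, hT t ht.2⟩
    have hw0 : ∀ t, 0 < timeWeight t := fun t => exp_pos _
    have h := subsolution_integral_le (U := U) (K := K) (q := q)
      (Ψ := fun z => timeWeight z.2 * (φ z * 1)) hU hK ht₀₁ hslab hq
      (hm.mul (hφs.contDiffOn.mul contDiffOn_const)) (fun z _ hz => by simp [hφzero z hz])
      (fun z _ => hq0 z)
      (fun z _ => mul_nonneg (hw0 _).le (mul_nonneg (hφ0 z) zero_le_one))
      (fun t => 1 / 2 * (1 + 1 / t)) (timeWeight t₀ * (C * t₀ ^ 2))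
      (fun y _ t ht => hle y t (hslab y t ht).1 (hslab y t ht).2) fun y _ t ht => by
        have hz := hslab y t ht
        have h1 := backward_op_weight hU (Γ := fun _ => 1) (φ := φ) (b := 1 / 2 * (1 + 1 / t))
          hm hφs.contDiffOn contDiffOn_const hz
          ((dirDeriv_comp_scalar (f := fun z : Sp n × ℝ => z.2) (hasDerivAt_timeWeight hz.1)
            differentiableAt_snd (tdir n)).trans (by simp [dirDeriv, fderiv_snd, tdir]))
          (fun w hw α => dirDeriv_sdir_time _ w α (hasDerivAt_timeWeight hw.1).differentiableAt)
          (hφt _) (by simp [spaceLap, dirDeriv_const, show ∀ α,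
            dirDeriv (sdir n α) (fun _ : Sp n × ℝ => (1 : ℝ)) = fun _ => 0 from
              fun α => funext fun _ => dirDeriv_const _ _])
        refine h1.le.trans ?_
        simp only [dirDeriv_const, mul_zero, Finset.sum_const_zero, add_zero, one_mul]
        have h2 := (le_abs_self _).trans (hφL (y, t))
        have h3 : C / (1 / t₀) ^ 2 = C * t₀ ^ 2 := by field_simp
        rw [h3] at h2
        exact (mul_le_mul_of_nonneg_left h2 (hw0 t).le).trans
          (mul_le_mul_of_nonneg_right (timeWeight_anti ht₀ ht.1) (by positivity))
    have hint : ∀ t ∈ Icc t₀ t₁, IntegrableOn (fun y => q (y, t)) K := fun t ht =>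
      (hslice t (ht₀.trans_le ht.1) (hT t ht.2)).continuousOn.integrableOn_compact hK
    have hφint : ∀ t ∈ Icc t₀ t₁,
        IntegrableOn (fun y => q (y, t) * (timeWeight t * (φ (y, t) * 1))) K := fun t ht =>
      ((hslice t (ht₀.trans_le ht.1) (hT t ht.2)).mul (continuous_const.mul
        ((hφs.continuous.comp (by fun_prop : Continuous fun y : Sp n => (y, t))).mul
          continuous_const))).continuousOn.integrableOn_compact hK
    have hsubK : ball x (1 / 2) ⊆ K := ball_subset_closedBall.trans
      (closedBall_subset_closedBall (by linarith))
    have hleft : timeWeight t₁ * ∫ y in ball x (1 / 2), q (y, t₁)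
        ≤ ∫ y in K, q (y, t₁) * (timeWeight t₁ * (φ (y, t₁) * 1)) := by
      have hi := hφint t₁ ⟨ht₀₁, le_rfl⟩
      rw [← integral_const_mul]
      calc ∫ y in ball x (1 / 2), timeWeight t₁ * q (y, t₁)
          = ∫ y in ball x (1 / 2), q (y, t₁) * (timeWeight t₁ * (φ (y, t₁) * 1)) := by
            refine setIntegral_congr_fun measurableSet_ball fun y hy => ?_
            have : dist y x ≤ 1 / t₀ / 2 := by linarith [mem_ball.1 hy]
            simp only [hφone (y, t₁) this]
            ring
        _ ≤ _ := setIntegral_mono_set hi (Filter.Eventually.of_forall fun y =>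
            mul_nonneg (hq0 _) (mul_nonneg (hw0 _).le (mul_nonneg (hφ0 _) zero_le_one)))
            (LE.le.eventuallyLE hsubK)
    have hinit : ∫ y in K, q (y, t₀) * (timeWeight t₀ * (φ (y, t₀) * 1))
        ≤ timeWeight t₀ * (t₀ * G) := by
      refine le_trans ?_ (mul_le_mul_of_nonneg_left (hG K hK t₀ ht₀ (hT _ ht₀₁)) (hw0 t₀).le)
      rw [← integral_const_mul]
      refine setIntegral_mono_on (hφint t₀ ⟨le_rfl, ht₀₁⟩)
        ((hint t₀ ⟨le_rfl, ht₀₁⟩).const_mul _) hK.measurableSet fun y _ => ?_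
      have h1 : q (y, t₀) * φ (y, t₀) ≤ q (y, t₀) := mul_le_of_le_one_right (hq0 _) (hφ1 _)
      have h2 := mul_le_mul_of_nonneg_left h1 (hw0 t₀).le
      linarith
    have hspace : ∫ z in K ×ˢ Ioc t₀ t₁, q z ≤ t₁ * (t₁ * G) := by
      have hqi : Integrable q ((volume.restrict K).prod (volume.restrict (Ioc t₀ t₁))) := by
        rw [Measure.prod_restrict, ← Measure.volume_eq_prod]
        exact hq.integrableOn_cylinder hK hslab
      rw [Measure.volume_eq_prod, ← Measure.prod_restrict, integral_prod _ hqi,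
        integral_integral_swap (f := fun y t => q (y, t)) hqi]
      calc ∫ t in Ioc t₀ t₁, ∫ y in K, q (y, t) ≤ ∫ _t in Ioc t₀ t₁, t₁ * G := by
            refine setIntegral_mono_on hqi.integral_prod_right (integrableOn_const (by simp))
              measurableSet_Ioc fun t ht => ?_
            exact (hG K hK t (ht₀.trans ht.1) (hT t ht.2)).trans
              (mul_le_mul_of_nonneg_right ht.2 hG0)
        _ = (t₁ - t₀) * (t₁ * G) := by
            rw [setIntegral_const, smul_eq_mul, Real.volume_real_Ioc_of_le ht₀₁]
        _ ≤ t₁ * (t₁ * G) := by gcongr; linarith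
    have hw : timeWeight t₀ * (C * t₀ ^ 2) ≤ √t₀ * C := by
      calc timeWeight t₀ * (C * t₀ ^ 2) = timeWeight t₀ * t₀ * (C * t₀) := by ring
        _ ≤ √t₀ * (C * 1) := by
          gcongr
          exact timeWeight_mul_le_sqrt ht₀
        _ = √t₀ * C := by ring
    calc timeWeight t₁ * ∫ y in ball x (1 / 2), q (y, t₁)
        ≤ timeWeight t₀ * (t₀ * G) + timeWeight t₀ * (C * t₀ ^ 2) * (t₁ * (t₁ * G)) :=
          (hleft.trans h).trans (add_le_add hinit
            (mul_le_mul_of_nonneg_left hspace (mul_nonneg (hw0 _).le (by positivity))))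
      _ ≤ √t₀ * G + √t₀ * C * (t₁ * (t₁ * G)) := by
          rw [← mul_assoc (timeWeight t₀) t₀ G]
          gcongr
          exact timeWeight_mul_le_sqrt ht₀
      _ = _ := by ring
  have hlim : Tendsto (fun t₀ => √t₀ * (G + C * (t₁ * (t₁ * G)))) (nhdsWithin 0 (Ioi 0))
      (nhds 0) := by
    have h : Continuous fun t₀ => √t₀ * (G + C * (t₁ * (t₁ * G))) := by fun_prop
    simpa using (h.tendsto 0).mono_left nhdsWithin_le_nhds
  have hle0 : timeWeight t₁ * ∫ y in ball x (1 / 2), q (y, t₁) ≤ 0 := by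
    refine ge_of_tendsto hlim ?_
    filter_upwards [Ioo_mem_nhdsGT (lt_min one_pos ht₁)] with t₀ h
    exact key t₀ h.1 h.2
  have hint0 : ∫ y in ball x (1 / 2), q (y, t₁) = 0 :=
    le_antisymm (nonpos_of_mul_nonpos_right hle0 (exp_pos _))
      (setIntegral_nonneg measurableSet_ball fun y _ => hq0 _)
  have hc := hslice t₁ ht₁ ht₁T
  have hae := (setIntegral_eq_zero_iff_of_nonneg_ae (Filter.Eventually.of_forall fun y => hq0 (y, t₁))
    ((hc.continuousOn.integrableOn_compact (isCompact_closedBall x (1 / 2))).mono_set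
      ball_subset_closedBall)).1 hint0
  exact Measure.eqOn_open_of_ae_eq hae isOpen_ball hc.continuousOn continuousOn_const
    (mem_ball_self (by norm_num))

end Vanishing

/-- Theorem 1.1 of the paper (case M = ℝⁿ, N = S^{k-1}): uniqueness of solutions of the
harmonic map heat flow with small renormalized energy. -/
theorem uniqueness_heat_flow_sphere_small_morrey
    (n k : ℕ) (hn : 2 ≤ n) (hk : 2 ≤ k) (p : ℝ) (hp1 : 1 < p) (hp2 : p ≤ 2) :
    ∃ ε₀ R₀ : ℝ, 0 < ε₀ ∧ 0 < R₀ ∧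
      ∀ (T : EReal), 0 < T →
      ∀ u₁ u₂ : Sp n × ℝ → Fin k → ℝ,
        ContinuousOn u₁ {z : Sp n × ℝ | 0 ≤ z.2 ∧ (z.2 : EReal) < T} →
        ContinuousOn u₂ {z : Sp n × ℝ | 0 ≤ z.2 ∧ (z.2 : EReal) < T} →
        SphereValued u₁ {z : Sp n × ℝ | 0 ≤ z.2 ∧ (z.2 : EReal) < T} →
        SphereValued u₂ {z : Sp n × ℝ | 0 ≤ z.2 ∧ (z.2 : EReal) < T} →
        ContDiffOn ℝ (⊤ : ℕ∞) u₁ {z : Sp n × ℝ | 0 < z.2 ∧ (z.2 : EReal) < T} →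
        ContDiffOn ℝ (⊤ : ℕ∞) u₂ {z : Sp n × ℝ | 0 < z.2 ∧ (z.2 : EReal) < T} →
        HeatFlow u₁ {z : Sp n × ℝ | 0 < z.2 ∧ (z.2 : EReal) < T} →
        HeatFlow u₂ {z : Sp n × ℝ | 0 < z.2 ∧ (z.2 : EReal) < T} →
        IntegrableOn (fun z => gradSq u₁ z + dtSq u₁ z)
          {z : Sp n × ℝ | 0 < z.2 ∧ (z.2 : EReal) < T} →
        IntegrableOn (fun z => gradSq u₂ z + dtSq u₂ z)
          {z : Sp n × ℝ | 0 < z.2 ∧ (z.2 : EReal) < T} →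
        (∀ x : Sp n, u₁ (x, 0) = u₂ (x, 0)) →
        MorreySmall u₁ T p R₀ ε₀ →
        MorreySmall u₂ T p R₀ ε₀ →
        ∀ z ∈ {z : Sp n × ℝ | 0 ≤ z.2 ∧ (z.2 : EReal) < T}, u₁ z = u₂ z := by
  obtain ⟨C, hC0, hC⟩ := exists_mean_value_const n
  have hp0 : p ≠ 0 := by linarith
  set c : ℝ := (1 / 64 : ℝ) ^ (p / 2) / (8 * C) with hc
  have hcpos : 0 < c := by positivity
  have hε : 4 * C * (c ^ (1 / p)) ^ p < (1 / 64 : ℝ) ^ (p / 2) := by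
    have h : 0 < (1 / 64 : ℝ) ^ (p / 2) := by positivity
    rw [← Real.rpow_mul hcpos.le, one_div_mul_cancel hp0, Real.rpow_one]
    have : 4 * C * c = (1 / 64 : ℝ) ^ (p / 2) / 2 := by rw [hc]; field_simp; norm_num
    linarith
  refine ⟨c ^ (1 / p), 1, by positivity, one_pos, ?_⟩
  intro T _ u₁ u₂ hc₁ hc₂ hs₁ hs₂ hu₁ hu₂ hf₁ hf₂ hi₁ hi₂ h0 hM₁ hM₂ z hz
  have hU := isOpen_strip (n := n) T
  have hsub : {z : Sp n × ℝ | 0 < z.2 ∧ (z.2 : EReal) < T}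
      ⊆ {z : Sp n × ℝ | 0 ≤ z.2 ∧ (z.2 : EReal) < T} := fun w hw => ⟨hw.1.le, hw.2⟩
  replace hs₁ : SphereValued u₁ {z : Sp n × ℝ | 0 < z.2 ∧ (z.2 : EReal) < T} :=
    fun w hw => hs₁ w (hsub hw)
  replace hs₂ : SphereValued u₂ {z : Sp n × ℝ | 0 < z.2 ∧ (z.2 : EReal) < T} :=
    fun w hw => hs₂ w (hsub hw)
  obtain ⟨x, t⟩ := z
  rcases (show 0 ≤ t from hz.1).eq_or_lt with rfl | ht
  · exact h0 x
  obtain ⟨G, hG0, hG⟩ := exists_integral_dist_sq_le hc₁ hc₂ hu₁ hu₂ hi₁ hi₂ h0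
  have hq0 : ∀ w, 0 ≤ ∑ i : Fin k, (u₁ w i - u₂ w i) ^ 2 := fun w =>
    Finset.sum_nonneg fun i _ => sq_nonneg _
  have hzero : ∑ i : Fin k, (u₁ (x, t) i - u₂ (x, t) i) ^ 2 = 0 :=
    eq_zero_of_heatOp_le (q := fun w => ∑ i : Fin k, (u₁ w i - u₂ w i) ^ 2)
      (ContDiffOn.sum fun i _ =>
        ((smoothOn_component hu₁ i).sub (smoothOn_component hu₂ i)).pow 2) hq0
      (fun y s hs hsT => by
        have h1 := hf₁.gradSq_le_of_morreySmall hC0 hC hp1 hp2 hε hu₁ hs₁ hM₁ y hs hsT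
        have h2 := hf₂.gradSq_le_of_morreySmall hC0 hC hp1 hp2 hε hu₂ hs₂ hM₂ y hs hsT
        refine (HeatFlow.heatOp_dist_sq_le hU hu₁ hu₂ hf₁ hf₂ hs₁ hs₂
          (show (y, s) ∈ _ from ⟨hs, hsT⟩)).trans ?_
        exact mul_le_mul_of_nonneg_right (by linarith) (hq0 _))
      hG0 hG x ht hz.2
  funext i
  have := (Finset.sum_eq_zero_iff_of_nonneg fun i _ => sq_nonneg _).1 hzero i (Finset.mem_univ i)
  exact sub_eq_zero.1 (pow_eq_zero_iff two_ne_zero |>.1 this)
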